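/- arXiv:math/0506088 — 2 statements merged into one kernel-verified Lean document; each statement's English description precedes it below -/
import Mathlib

section
/- Let (A_1,A_2) and (B_1,B_2) be two noncomparable pairs indexing minors of the generic r×d matrix X. Then in K[Z] there is a straightening relation p(A_1,A_2)p(B_1,B_2) = Σ_i a_i p(C_{i1},C_{i2}) p(D_{i1},D_{i2}) with finitely many terms and a_i ∈ K∖{0}, in which every summand p(C_{i1},C_{i2})p(D_{i1},D_{i2}) is standard (i.e. (C_{i1},C_{i2}) ⪰ (D_{i1},D_{i2})), and such that for every i: C_{i1} ≥ A_1 and C_{i1} ≥ B_1, C_{i2} ≥ A_2 and C_{i2} ≥ B_2, D_{i1} ≤ A_1 and D_{i1} ≤ B_1, D_{i2} ≤ A_2 and D_{i2} ≤ B_2; moreover the term p((A_1,A_2)∨(B_1,B_2))·p((A_1,A_2)∧(B_1,B_2)), where join and meet are taken componentwise (entrywise max, resp. min, of the tuples), occurs on the right-hand side with coefficient 1. Here p(∅,∅) is interpreted as the constant 1, and (∅,∅) is the largest pair. -/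
namespace SMB

/-- `geTup f g` : the strictly increasing tuple `f` is `≥` the strictly increasing tuple `g`
in the order on increasing tuples: the length of `f` is at most that of `g`, and `f` is
entrywise `≥` `g` (on the common range of indices). -/
def geTup {N s s' : ℕ} (f : Fin s → Fin N) (g : Fin s' → Fin N) : Prop :=
  ∃ h : s ≤ s', ∀ j : Fin s, g (Fin.castLE h j) ≤ f j

/-- A strictly increasing `s`-tuple with values in `{1,…,N}` (encoded as `Fin N`). -/
structure IncTup (s N : ℕ) where
  f : Fin s → Fin N
  mono : StrictMono f

/-- A pair of strictly increasing tuples of a common length `s`: row indices in `{1,…,m}`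
and column indices in `{1,…,q}`, indexing an `s × s` minor. -/
structure PairIx (m q : ℕ) where
  s : ℕ
  rows : Fin s → Fin m
  cols : Fin s → Fin q
  rmono : StrictMono rows
  cmono : StrictMono cols

/-- The partial order `(A,B) ⪰ (A',B')` on pairs of increasing tuples: `A ≥ A'` and `B ≥ B'`. -/
def PairIx.ge {m q : ℕ} (x y : PairIx m q) : Prop :=
  geTup x.rows y.rows ∧ geTup x.cols y.cols

end SMB
namespace SMB

variable (K : Type) [Field K] (r d : ℕ)

/-- The polynomial ring `K[Z] = K[x_{ij} : 1 ≤ i ≤ r, 1 ≤ j ≤ d]` in the entries of a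
generic `r×d` matrix `X`. -/
abbrev KZ := MvPolynomial (Fin r × Fin d) K

/-- The minor `p(A,B)` of the generic `r×d` matrix `X`, with row indices `A` and column
indices `B` (for the empty pair of tuples this is the constant `1`). -/
noncomputable def minorPoly (x : PairIx r d) : KZ K r d :=
  Matrix.det (Matrix.of fun i j : Fin x.s => MvPolynomial.X (x.rows i, x.cols j))

/-- The ideal `I_t(X)` of `K[Z]` generated by all `t×t` minors of the generic `r×d` matrix. -/
noncomputable def minorIdeal (t : ℕ) : Ideal (KZ K r d) :=
  Ideal.span {f | ∃ x : PairIx r d, x.s = t ∧ f = minorPoly K r d x}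

end SMB
namespace SMB

/-- `tupJoinEq f g h` : the increasing tuple `h` is the componentwise join (entrywise
maximum) of the tuples `f` and `g`: its length is `min` of the two lengths and its entries
are the entrywise maxima. -/
def tupJoinEq {N s s' s'' : ℕ} (f : Fin s → Fin N) (g : Fin s' → Fin N)
    (h : Fin s'' → Fin N) : Prop :=
  s'' = min s s' ∧
    ∀ (j : ℕ) (hj : j < s'') (hf : j < s) (hg : j < s'),
      (h ⟨j, hj⟩ : ℕ) = max (f ⟨j, hf⟩ : ℕ) (g ⟨j, hg⟩ : ℕ)

/-- `tupMeetEq f g h` : the increasing tuple `h` is the componentwise meet (entrywise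
minimum) of the tuples `f` and `g`: its length is `max` of the two lengths, its entries are
the entrywise minima where both tuples are defined, and the entries of the longer tuple
beyond that. -/
def tupMeetEq {N s s' s'' : ℕ} (f : Fin s → Fin N) (g : Fin s' → Fin N)
    (h : Fin s'' → Fin N) : Prop :=
  s'' = max s s' ∧
    (∀ (j : ℕ) (hj : j < s'') (hf : j < s) (hg : j < s'),
      (h ⟨j, hj⟩ : ℕ) = min (f ⟨j, hf⟩ : ℕ) (g ⟨j, hg⟩ : ℕ)) ∧
    (∀ (j : ℕ) (hj : j < s'') (hf : j < s), ¬ j < s' → (h ⟨j, hj⟩ : ℕ) = (f ⟨j, hf⟩ : ℕ)) ∧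
    (∀ (j : ℕ) (hj : j < s'') (hg : j < s'), ¬ j < s → (h ⟨j, hj⟩ : ℕ) = (g ⟨j, hg⟩ : ℕ))

end SMB

namespace SMB

/-- The alternating map in the arguments indexed by `p` obtained from `f` by fixing the others. -/
noncomputable def alternatingRestrict {R M N ι : Type*} [CommRing R] [AddCommGroup M] [Module R M]
    [AddCommGroup N] [Module R N] (f : M [⋀^ι]→ₗ[R] N) (p : ι → Prop) [DecidablePred p]
    (z : {a // ¬ p a} → M) : M [⋀^{a // p a}]→ₗ[R] N :=
  { f.toMultilinearMap.domDomRestrict p z with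
    map_eq_zero_of_eq' := by
      intro v i j hv hij
      refine f.map_eq_zero_of_eq (i := i.1) (j := j.1) _ ?_ (fun h => hij (Subtype.ext h))
      simpa [i.2, j.2] using hv }

theorem alternatingRestrict_apply {R M N ι : Type*} [CommRing R] [AddCommGroup M] [Module R M]
    [AddCommGroup N] [Module R N] (f : M [⋀^ι]→ₗ[R] N) (p : ι → Prop) [DecidablePred p]
    (z : {a // ¬ p a} → M) (v : {a // p a} → M) :
    alternatingRestrict f p z v = f fun j => if h : p j then v ⟨j, h⟩ else z ⟨j, h⟩ := rfl

/-- The maximal minor of the generic `r × n` matrix with columns `u`. -/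
noncomputable def pluecker (K : Type*) [Field K] {r n : ℕ} (u : Fin r → Fin n) :
    MvPolynomial (Fin r × Fin n) K :=
  Matrix.det (Matrix.of fun i j => MvPolynomial.X (i, u j))

section Exchange

variable {K : Type*} [Field K] {r n : ℕ}

/-- The columns of the generic matrix. -/
noncomputable def genericCol (K : Type*) [Field K] {r n : ℕ} (c : Fin n) :
    Fin r → MvPolynomial (Fin r × Fin n) K :=
  fun i => MvPolynomial.X (i, c)

theorem pluecker_eq_alternating (u : Fin r → Fin n) :
    pluecker K u = Matrix.detRowAlternating fun j => genericCol K (u j) := by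
  rw [pluecker, ← Matrix.det_transpose]
  rfl

theorem pluecker_comp_perm (u : Fin r → Fin n) (σ : Equiv.Perm (Fin r)) :
    pluecker K (u ∘ σ) = Equiv.Perm.sign σ • pluecker K u := by
  rw [pluecker_eq_alternating, pluecker_eq_alternating]
  exact (Matrix.detRowAlternating (n := Fin r)
    (R := MvPolynomial (Fin r × Fin n) K)).map_perm
    (fun j => genericCol K (u j)) σ

theorem pluecker_eq_zero {u : Fin r → Fin n} (h : ¬ Function.Injective u) :
    pluecker K u = 0 := by
  rw [pluecker_eq_alternating]
  refine AlternatingMap.map_eq_zero_of_not_injective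
    (Matrix.detRowAlternating (n := Fin r)) _ fun h' => h fun a b hab => h' ?_
  simp [hab]

/-- The columns of the first factor after an exchange by `σ`. -/
def exchangeLeft (u v : Fin r → Fin n) (i : Fin r)
    (σ : Equiv.Perm ({j : Fin r // i ≤ j} ⊕ {j : Fin r // j ≤ i})) (j : Fin r) : Fin n :=
  if h : i ≤ j then Sum.elim (fun k => u k.1) (fun k => v k.1) (σ (Sum.inl ⟨j, h⟩)) else u j

/-- The columns of the second factor after an exchange by `σ`. -/
def exchangeRight (u v : Fin r → Fin n) (i : Fin r)
    (σ : Equiv.Perm ({j : Fin r // i ≤ j} ⊕ {j : Fin r // j ≤ i})) (j : Fin r) : Fin n :=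
  if h : j ≤ i then Sum.elim (fun k => u k.1) (fun k => v k.1) (σ (Sum.inr ⟨j, h⟩)) else v j

theorem not_linearIndependent_of_card_lt {R ι : Type*} [CommRing R] [IsDomain R] [Fintype ι]
    (h : r < Fintype.card ι) (w : ι → Fin r → R) : ¬ LinearIndependent R w := by
  intro hw
  have := hw.fintype_card_le_finrank
  simp at this
  omega

theorem exchange_relation (u v : Fin r → Fin n) (i : Fin r) :
    pluecker K u * pluecker K v ∈ Submodule.span K
      {f | ∃ σ : Equiv.Perm ({j : Fin r // i ≤ j} ⊕ {j : Fin r // j ≤ i}),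
        σ ∉ (Equiv.Perm.sumCongrHom {j : Fin r // i ≤ j} {j : Fin r // j ≤ i}).range ∧
        f = pluecker K (exchangeLeft u v i σ) * pluecker K (exchangeRight u v i σ)} := by
  classical
  let R := MvPolynomial (Fin r × Fin n) K
  let D : (Fin r → R) [⋀^Fin r]→ₗ[R] R := Matrix.detRowAlternating
  let a := alternatingRestrict D (fun j => i ≤ j) fun k => genericCol K (u k.1)
  let b := alternatingRestrict D (fun j => j ≤ i) fun k => genericCol K (v k.1)
  let F := (LinearMap.mul' R R).compAlternatingMap (a.domCoprod b)
  let w : {j : Fin r // i ≤ j} ⊕ {j : Fin r // j ≤ i} → Fin r → R :=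
    fun k => genericCol K (Sum.elim (fun k => u k.1) (fun k => v k.1) k)
  have hF : F w = 0 := by
    refine AlternatingMap.map_linearDependent _ _ (not_linearIndependent_of_card_lt ?_ _)
    have h1 : Fintype.card {j : Fin r // i ≤ j} = r - i := by
      rw [Fintype.card_subtype]
      have : (Finset.univ.filter fun j : Fin r => i ≤ j) = Finset.Ici i := by ext; simp
      rw [this, Fin.card_Ici]
    have h2 : Fintype.card {j : Fin r // j ≤ i} = i + 1 := by
      rw [Fintype.card_subtype]
      have : (Finset.univ.filter fun j : Fin r => j ≤ i) = Finset.Iic i := by ext; simp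
      rw [this, Fin.card_Iic]
    rw [Fintype.card_sum, h1, h2]
    omega
  have hterm : ∀ σ : Equiv.Perm ({j : Fin r // i ≤ j} ⊕ {j : Fin r // j ≤ i}),
      LinearMap.mul' R R (AlternatingMap.domCoprod.summand a b (Quotient.mk'' σ) w) =
        Equiv.Perm.sign σ •
          (pluecker K (exchangeLeft u v i σ) * pluecker K (exchangeRight u v i σ)) := by
    intro σ
    rw [AlternatingMap.domCoprod.summand_mk'', pluecker_eq_alternating, pluecker_eq_alternating,
      smul_apply, LinearMap.map_smul_of_tower]
    congr 1
    rw [MultilinearMap.domDomCongr_apply, MultilinearMap.domCoprod_apply, LinearMap.mul'_apply]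
    congr 1
    · change alternatingRestrict D _ _ _ = _
      rw [alternatingRestrict_apply]
      change D _ = D _
      congr 1
      ext1 j
      by_cases h : i ≤ j <;> simp [exchangeLeft, h, w]
    · change alternatingRestrict D _ _ _ = _
      rw [alternatingRestrict_apply]
      change D _ = D _
      congr 1
      ext1 j
      by_cases h : j ≤ i <;> simp [exchangeRight, h, w]
  have hsum : F w = ∑ q : Equiv.Perm.ModSumCongr {j : Fin r // i ≤ j} {j : Fin r // j ≤ i},
      LinearMap.mul' R R (AlternatingMap.domCoprod.summand a b q w) := by
    rw [← map_sum, ← sum_apply]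
    rfl
  have h1 : LinearMap.mul' R R (AlternatingMap.domCoprod.summand a b (Quotient.mk'' 1) w) =
      pluecker K u * pluecker K v := by
    rw [hterm]
    have e1 : exchangeLeft u v i 1 = u := by ext j; simp [exchangeLeft]
    have e2 : exchangeRight u v i 1 = v := by ext j; simp [exchangeRight]
    simp [e1, e2]
  let q₁ : Equiv.Perm.ModSumCongr {j : Fin r // i ≤ j} {j : Fin r // j ≤ i} := Quotient.mk'' 1
  rw [hsum, ← Finset.add_sum_erase Finset.univ
    (fun q => LinearMap.mul' R R (AlternatingMap.domCoprod.summand a b q w))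
    (Finset.mem_univ q₁), h1] at hF
  rw [eq_neg_of_add_eq_zero_left hF]
  refine neg_mem (sum_mem fun q hq => ?_)
  induction q using Quotient.inductionOn' with | _ σ
  rw [hterm]
  have hm : pluecker K (exchangeLeft u v i σ) * pluecker K (exchangeRight u v i σ) ∈
      Submodule.span K
      {f | ∃ σ : Equiv.Perm ({j : Fin r // i ≤ j} ⊕ {j : Fin r // j ≤ i}),
        σ ∉ (Equiv.Perm.sumCongrHom {j : Fin r // i ≤ j} {j : Fin r // j ≤ i}).range ∧
        f = pluecker K (exchangeLeft u v i σ) * pluecker K (exchangeRight u v i σ)} := by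
    refine Submodule.subset_span ⟨σ, fun h => (Finset.mem_erase.mp hq).1 ?_, rfl⟩
    refine Quotient.sound' ?_
    rw [QuotientGroup.leftRel_apply]
    simpa using h
  rcases Int.units_eq_one_or (Equiv.Perm.sign σ) with h | h <;> rw [h]
  · simpa using hm
  · simpa using hm

theorem sum_exchangeLeft_lt {u v : Fin r → Fin n} (hu : StrictMono u) (hv : StrictMono v)
    {i : Fin r} (hi : v i < u i)
    {σ : Equiv.Perm ({j : Fin r // i ≤ j} ⊕ {j : Fin r // j ≤ i})}
    (hσ : σ ∉ (Equiv.Perm.sumCongrHom {j : Fin r // i ≤ j} {j : Fin r // j ≤ i}).range) :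
    ∑ j, (exchangeLeft u v i σ j : ℕ) < ∑ j, (u j : ℕ) := by
  classical
  let L : {j : Fin r // i ≤ j} ⊕ {j : Fin r // j ≤ i} → ℕ :=
    Sum.elim (fun k => u k.1) (fun k => v k.1)
  have key : ∑ j : {j : Fin r // i ≤ j}, L (σ (Sum.inl j)) <
      ∑ j : {j : Fin r // i ≤ j}, L (Sum.inl j) := by
    let S : Finset ({j : Fin r // i ≤ j} ⊕ {j : Fin r // j ≤ i}) :=
      Finset.univ.image fun j => σ (Sum.inl j)
    let T : Finset ({j : Fin r // i ≤ j} ⊕ {j : Fin r // j ≤ i}) :=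
      Finset.univ.image fun j => Sum.inl j
    have hS : ∑ j : {j : Fin r // i ≤ j}, L (σ (Sum.inl j)) = ∑ k ∈ S, L k := by
      rw [Finset.sum_image]
      intro a _ b _ h
      simpa using h
    have hT : ∑ j : {j : Fin r // i ≤ j}, L (Sum.inl j) = ∑ k ∈ T, L k := by
      rw [Finset.sum_image]
      intro a _ b _ h
      simpa using h
    have hcard : S.card = T.card := by
      rw [Finset.card_image_of_injective, Finset.card_image_of_injective]
      · exact Sum.inl_injective
      · exact σ.injective.comp Sum.inl_injective
    have hcard' : (S \ T).card = (T \ S).card := Finset.card_sdiff_comm hcard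
    have hne : (S \ T).Nonempty := by
      by_contra hne
      rw [Finset.not_nonempty_iff_eq_empty, Finset.sdiff_eq_empty_iff_subset] at hne
      refine hσ (Equiv.Perm.mem_sumCongrHom_range_of_perm_mapsTo_inl ?_)
      rintro _ ⟨j, rfl⟩
      have : σ (Sum.inl j) ∈ T := hne (Finset.mem_image_of_mem _ (Finset.mem_univ j))
      obtain ⟨k, -, hk⟩ := Finset.mem_image.mp this
      exact ⟨k, hk⟩
    rw [hS, hT, ← Finset.sum_inter_add_sum_sdiff S T, ← Finset.sum_inter_add_sum_sdiff T S,
      Finset.inter_comm T S]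
    refine Nat.add_lt_add_left ?_ _
    have h1 : ∑ k ∈ S \ T, L k ≤ (S \ T).card • (v i : ℕ) := by
      refine Finset.sum_le_card_nsmul _ _ _ fun k hk => ?_
      rcases k with k | k
      · exact absurd (Finset.mem_image_of_mem _ (Finset.mem_univ k)) (Finset.mem_sdiff.mp hk).2
      · exact hv.monotone k.2
    have h2 : (T \ S).card • (u i : ℕ) ≤ ∑ k ∈ T \ S, L k := by
      refine Finset.card_nsmul_le_sum _ _ _ fun k hk => ?_
      obtain ⟨k, -, rfl⟩ := Finset.mem_image.mp (Finset.mem_sdiff.mp hk).1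
      exact hu.monotone k.2
    refine h1.trans_lt (lt_of_lt_of_le ?_ h2)
    rw [← hcard', smul_eq_mul, smul_eq_mul]
    exact Nat.mul_lt_mul_of_pos_left hi (Finset.card_pos.mpr hne)
  have split : ∀ f : Fin r → ℕ, ∑ j, f j =
      ∑ j : {j : Fin r // i ≤ j}, f j + ∑ j : {j : Fin r // ¬ i ≤ j}, f j := fun f =>
    (Fintype.sum_subtype_add_sum_subtype _ _).symm
  rw [split, split fun j => (u j : ℕ)]
  have e1 : ∑ j : {j : Fin r // i ≤ j}, (exchangeLeft u v i σ j : ℕ) =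
      ∑ j : {j : Fin r // i ≤ j}, L (σ (Sum.inl j)) := by
    refine Finset.sum_congr rfl fun j _ => ?_
    simp only [exchangeLeft, j.2, dif_pos, L]
    rcases σ (Sum.inl j) with k | k <;> rfl
  have e2 : ∑ j : {j : Fin r // ¬ i ≤ j}, (exchangeLeft u v i σ j : ℕ) =
      ∑ j : {j : Fin r // ¬ i ≤ j}, (u j : ℕ) := by
    refine Finset.sum_congr rfl fun j _ => ?_
    simp only [exchangeLeft, j.2, dif_neg, not_false_eq_true]
  rw [e1, e2]
  exact Nat.add_lt_add_right key _

theorem exists_strictMono_comp_perm {u : Fin r → Fin n} (hu : Function.Injective u) :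
    ∃ σ : Equiv.Perm (Fin r), StrictMono (u ∘ σ) :=
  ⟨Tuple.sort u, (Tuple.monotone_sort u).strictMono_of_injective
    (hu.comp (Equiv.injective _))⟩

theorem pluecker_mul_mem_span (u v : Fin r → Fin n) :
    pluecker K u * pluecker K v ∈ Submodule.span K
      {f | ∃ C D : Fin r → Fin n, StrictMono C ∧ StrictMono D ∧ D ≤ C ∧
        f = pluecker K C * pluecker K D} := by
  induction hm : ∑ j, (u j : ℕ) using Nat.strong_induction_on generalizing u v with
  | _ m ih =>
  by_cases hu : Function.Injective u; swap
  · simp [pluecker_eq_zero hu]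
  by_cases hv : Function.Injective v; swap
  · simp [pluecker_eq_zero hv]
  obtain ⟨σ, hσ⟩ := exists_strictMono_comp_perm hu
  obtain ⟨π, hπ⟩ := exists_strictMono_comp_perm hv
  have hsum : ∑ j, ((u ∘ σ) j : ℕ) = m := by
    rw [← hm]
    exact Equiv.sum_comp σ fun j => (u j : ℕ)
  suffices h : pluecker K (u ∘ σ) * pluecker K (v ∘ π) ∈ Submodule.span K
      {f | ∃ C D : Fin r → Fin n, StrictMono C ∧ StrictMono D ∧ D ≤ C ∧
        f = pluecker K C * pluecker K D} by
    rw [pluecker_comp_perm, pluecker_comp_perm] at h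
    rcases Int.units_eq_one_or (Equiv.Perm.sign σ) with h1 | h1 <;>
    rcases Int.units_eq_one_or (Equiv.Perm.sign π) with h2 | h2 <;>
    simpa [h1, h2] using h
  by_cases hle : u ∘ σ ≤ v ∘ π
  · exact Submodule.subset_span ⟨_, _, hπ, hσ, hle, mul_comm _ _⟩
  · rw [Pi.le_def] at hle
    push Not at hle
    obtain ⟨i, hi⟩ := hle
    refine Submodule.span_le.mpr ?_ (exchange_relation (u ∘ σ) (v ∘ π) i)
    rintro _ ⟨τ, hτ, rfl⟩
    exact ih _ (hsum ▸ sum_exchangeLeft_lt hσ hπ hi hτ) _ _ rfl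

end Exchange

section Weights

variable {K : Type*} [Field K] {r n : ℕ}

/-- Pairs of a weight on rows and a weight on columns varying in opposite directions. -/
abbrev AntitonePair (r n : ℕ) : Type :=
  {p : (Fin r → ℕ) × (Fin n → ℕ) //
    (Monotone p.1 ∧ Antitone p.2) ∨ (Antitone p.1 ∧ Monotone p.2)}

theorem AntitonePair.antivary (p : AntitonePair r n) {u : Fin r → Fin n} (hu : StrictMono u) :
    Antivary p.1.1 (p.1.2 ∘ u) := by
  rcases p.2 with h | h
  · exact h.1.antivary (h.2.comp_monotone hu.monotone)
  · exact h.1.antivary (h.2.comp hu.monotone)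

/-- The weight of the diagonal monomial of `pluecker u * pluecker v`, for every weight. -/
def diagWeight (u v : Fin r → Fin n) (p : AntitonePair r n) : ℕ :=
  ∑ i, p.1.1 i * p.1.2 (u i) + ∑ i, p.1.1 i * p.1.2 (v i)

/-- The exponent of the monomial of `pluecker u` belonging to the permutation `σ`. -/
noncomputable def permExponent (u : Fin r → Fin n) (σ : Equiv.Perm (Fin r)) :
    Fin r × Fin n →₀ ℕ :=
  ∑ i, Finsupp.single (σ i, u i) 1

/-- The weight of a monomial. -/
noncomputable def monomialWeight (p : AntitonePair r n) : (Fin r × Fin n →₀ ℕ) →+ ℕ :=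
  Finsupp.liftAddHom fun c => AddMonoidHom.mulLeft (p.1.1 c.1 * p.1.2 c.2)

theorem monomialWeight_permExponent (p : AntitonePair r n) (u : Fin r → Fin n)
    (σ : Equiv.Perm (Fin r)) :
    monomialWeight p (permExponent u σ) = ∑ i, p.1.1 (σ i) * p.1.2 (u i) := by
  simp [monomialWeight, permExponent, map_sum]

theorem le_monomialWeight_permExponent (p : AntitonePair r n) {u : Fin r → Fin n}
    (hu : StrictMono u) (σ : Equiv.Perm (Fin r)) :
    ∑ i, p.1.1 i * p.1.2 (u i) ≤ monomialWeight p (permExponent u σ) := by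
  rw [monomialWeight_permExponent]
  exact (p.antivary hu).sum_smul_le_sum_comp_perm_smul

theorem monomialWeight_diag (p : AntitonePair r n) (u v : Fin r → Fin n) :
    monomialWeight p (permExponent u 1 + permExponent v 1) = diagWeight u v p := by
  simp [monomialWeight_permExponent, diagWeight]

/-- The weight counting the entries in rows `≥ k` and columns `≤ c`. -/
def lowerLeftWeight (k : Fin r) (c : Fin n) : AntitonePair r n :=
  ⟨(fun i => if k ≤ i then 1 else 0, fun a => if a ≤ c then 1 else 0), Or.inl
    ⟨fun a b h => by dsimp only; split_ifs <;> omega,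
      fun a b h => by dsimp only; split_ifs <;> omega⟩⟩

/-- The weight counting the entries in rows `≤ k` and columns `≥ c`. -/
def upperRightWeight (k : Fin r) (c : Fin n) : AntitonePair r n :=
  ⟨(fun i => if i ≤ k then 1 else 0, fun a => if c ≤ a then 1 else 0), Or.inr
    ⟨fun a b h => by dsimp only; split_ifs <;> omega,
      fun a b h => by dsimp only; split_ifs <;> omega⟩⟩

theorem eq_one_of_forall_le {σ : Equiv.Perm (Fin r)} (h : ∀ i, σ i ≤ i) : σ = 1 := by
  have hs : ∑ i, ((σ i : Fin r) : ℕ) = ∑ i : Fin r, (i : ℕ) := Equiv.sum_comp σ fun i => (i : ℕ)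
  have := (Finset.sum_eq_sum_iff_of_le fun i _ =>
    (Fin.le_def.mp (h i) : ((σ i : Fin r) : ℕ) ≤ i)).mp hs
  ext i
  exact this i (Finset.mem_univ i)

theorem eq_one_of_monomialWeight_eq {u : Fin r → Fin n} (hu : StrictMono u)
    {σ : Equiv.Perm (Fin r)}
    (h : ∀ p, monomialWeight p (permExponent u σ) = ∑ i, p.1.1 i * p.1.2 (u i)) : σ = 1 := by
  refine eq_one_of_forall_le fun i => ?_
  by_contra! hi
  have := h (lowerLeftWeight (σ i) (u i))
  rw [monomialWeight_permExponent] at this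
  have h0 : ∑ l, (lowerLeftWeight (σ i) (u i)).1.1 l *
      (lowerLeftWeight (σ i) (u i)).1.2 (u l) = 0 := by
    refine Finset.sum_eq_zero fun l _ => ?_
    simp only [lowerLeftWeight, mul_eq_zero, ite_eq_right_iff, one_ne_zero, imp_false, not_le,
      hu.lt_iff_lt]
    by_contra! hl
    order
  rw [h0, Finset.sum_eq_zero_iff] at this
  simpa [lowerLeftWeight] using this i (Finset.mem_univ i)

theorem le_of_diagWeight_le {C D u v : Fin r → Fin n} (hC : StrictMono C) (hD : StrictMono D)
    (hDC : D ≤ C) (h : diagWeight u v ≤ diagWeight C D) : D ≤ u ∧ D ≤ v ∧ u ≤ C ∧ v ≤ C := by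
  have lower : ∀ i, ∀ c < D i, c < u i ∧ c < v i := by
    intro i c hc
    have h1 := h (lowerLeftWeight i c)
    have h0 : diagWeight C D (lowerLeftWeight i c) = 0 := by
      simp only [diagWeight, lowerLeftWeight, Nat.add_eq_zero_iff, Finset.sum_eq_zero_iff]
      constructor <;> intro l _ <;>
        simp only [mul_eq_zero, ite_eq_right_iff, one_ne_zero, imp_false, not_le] <;>
        by_contra! hl
      · have := hDC l
        have := hD.monotone hl.1
        order
      · have := hD.monotone hl.1
        order
    rw [h0, Nat.le_zero, diagWeight, Nat.add_eq_zero_iff, Finset.sum_eq_zero_iff,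
      Finset.sum_eq_zero_iff] at h1
    have h2 := h1.1 i (Finset.mem_univ i)
    have h3 := h1.2 i (Finset.mem_univ i)
    simp only [lowerLeftWeight, le_refl, if_true, one_mul, ite_eq_right_iff, one_ne_zero,
      imp_false, not_le] at h2 h3
    exact ⟨h2, h3⟩
  have upper : ∀ i, ∀ c, C i < c → u i < c ∧ v i < c := by
    intro i c hc
    have h1 := h (upperRightWeight i c)
    have h0 : diagWeight C D (upperRightWeight i c) = 0 := by
      simp only [diagWeight, upperRightWeight, Nat.add_eq_zero_iff, Finset.sum_eq_zero_iff]
      constructor <;> intro l _ <;>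
        simp only [mul_eq_zero, ite_eq_right_iff, one_ne_zero, imp_false, not_le] <;>
        by_contra! hl
      · have := hC.monotone hl.1
        order
      · have := hDC l
        have := hC.monotone hl.1
        order
    rw [h0, Nat.le_zero, diagWeight, Nat.add_eq_zero_iff, Finset.sum_eq_zero_iff,
      Finset.sum_eq_zero_iff] at h1
    have h2 := h1.1 i (Finset.mem_univ i)
    have h3 := h1.2 i (Finset.mem_univ i)
    simp only [upperRightWeight, le_refl, if_true, one_mul, ite_eq_right_iff, one_ne_zero,
      imp_false, not_le] at h2 h3
    exact ⟨h2, h3⟩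
  refine ⟨fun i => ?_, fun i => ?_, fun i => ?_, fun i => ?_⟩ <;> by_contra! hi
  · exact lt_irrefl _ (lower i _ hi).1
  · exact lt_irrefl _ (lower i _ hi).2
  · exact lt_irrefl _ (upper i _ hi).1
  · exact lt_irrefl _ (upper i _ hi).2

theorem pluecker_eq_sum (u : Fin r → Fin n) :
    pluecker K u = ∑ σ : Equiv.Perm (Fin r),
      Equiv.Perm.sign σ • MvPolynomial.monomial (permExponent u σ) 1 := by
  rw [pluecker, Matrix.det_apply]
  refine Finset.sum_congr rfl fun σ _ => ?_
  rw [permExponent, MvPolynomial.monomial_sum_one]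
  rfl

theorem coeff_pluecker_mul (u v : Fin r → Fin n) (m : Fin r × Fin n →₀ ℕ) :
    MvPolynomial.coeff m (pluecker K u * pluecker K v) =
      ∑ σ : Equiv.Perm (Fin r), ∑ π : Equiv.Perm (Fin r),
        if permExponent u σ + permExponent v π = m then
          ((Equiv.Perm.sign σ * Equiv.Perm.sign π : ℤˣ) : ℤ) • (1 : K) else 0 := by
  classical
  rw [pluecker_eq_sum, pluecker_eq_sum, Finset.sum_mul_sum, MvPolynomial.coeff_sum]
  refine Finset.sum_congr rfl fun σ _ => ?_
  rw [MvPolynomial.coeff_sum]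
  refine Finset.sum_congr rfl fun π _ => ?_
  rw [smul_mul_smul_comm, MvPolynomial.monomial_mul, one_mul, Units.smul_def,
    MvPolynomial.coeff_smul, MvPolynomial.coeff_monomial, smul_ite, smul_zero]

theorem diagWeight_le_of_coeff_ne_zero {u v : Fin r → Fin n} (hu : StrictMono u)
    (hv : StrictMono v) {m : Fin r × Fin n →₀ ℕ}
    (h : MvPolynomial.coeff m (pluecker K u * pluecker K v) ≠ 0) (p : AntitonePair r n) :
    diagWeight u v p ≤ monomialWeight p m := by
  rw [coeff_pluecker_mul] at h
  obtain ⟨σ, -, h⟩ := Finset.exists_ne_zero_of_sum_ne_zero h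
  obtain ⟨π, -, h⟩ := Finset.exists_ne_zero_of_sum_ne_zero h
  rw [ne_eq, ite_eq_right_iff, Classical.not_imp] at h
  rw [← h.1, map_add]
  exact add_le_add (le_monomialWeight_permExponent p hu σ) (le_monomialWeight_permExponent p hv π)

theorem coeff_diag_pluecker_mul {u v : Fin r → Fin n} (hu : StrictMono u) (hv : StrictMono v) :
    MvPolynomial.coeff (permExponent u 1 + permExponent v 1) (pluecker K u * pluecker K v) = 1 := by
  have key : ∀ σ π, permExponent u σ + permExponent v π = permExponent u 1 + permExponent v 1 →
      σ = 1 ∧ π = 1 := by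
    intro σ π h
    have h1 : ∀ p : AntitonePair r n, monomialWeight p (permExponent u σ) +
        monomialWeight p (permExponent v π) = diagWeight u v p := fun p => by
      rw [← map_add, h, monomialWeight_diag]
    simp only [diagWeight] at h1
    constructor
    · refine eq_one_of_monomialWeight_eq hu fun p => ?_
      have := h1 p
      have := le_monomialWeight_permExponent p hu σ
      have := le_monomialWeight_permExponent p hv π
      omega
    · refine eq_one_of_monomialWeight_eq hv fun p => ?_
      have := h1 p
      have := le_monomialWeight_permExponent p hu σ
      have := le_monomialWeight_permExponent p hv π
      omega
  rw [coeff_pluecker_mul, Finset.sum_eq_single 1, Finset.sum_eq_single 1]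
  · simp
  · exact fun π _ hπ => if_neg fun h => hπ (key _ _ h).2
  · simp
  · exact fun σ _ hσ => Finset.sum_eq_zero fun π _ => if_neg fun h => hσ (key _ _ h).1
  · simp

theorem permExponent_sup_add_inf (u v : Fin r → Fin n) :
    permExponent (u ⊔ v) 1 + permExponent (u ⊓ v) 1 = permExponent u 1 + permExponent v 1 := by
  rw [permExponent, permExponent, permExponent, permExponent, ← Finset.sum_add_distrib,
    ← Finset.sum_add_distrib]
  refine Finset.sum_congr rfl fun i _ => ?_
  rcases le_total (u i) (v i) with h | h
  · simp [h, add_comm]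
  · simp [h]

theorem eq_of_diagWeight_eq {C D C' D' : Fin r → Fin n} (hC : StrictMono C) (hD : StrictMono D)
    (hDC : D ≤ C) (hC' : StrictMono C') (hD' : StrictMono D') (hDC' : D' ≤ C')
    (h : diagWeight C D = diagWeight C' D') : C = C' ∧ D = D' := by
  have h1 := le_of_diagWeight_le hC hD hDC h.ge
  have h2 := le_of_diagWeight_le hC' hD' hDC' h.le
  exact ⟨le_antisymm h2.2.2.1 h1.2.2.1, le_antisymm h1.2.1 h2.2.1⟩

theorem pluecker_straightening {u v : Fin r → Fin n} (hu : StrictMono u) (hv : StrictMono v) :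
    ∃ (S : Finset ((Fin r → Fin n) × (Fin r → Fin n)))
      (c : (Fin r → Fin n) × (Fin r → Fin n) → K),
      pluecker K u * pluecker K v = ∑ s ∈ S, c s • (pluecker K s.1 * pluecker K s.2) ∧
      (∀ s ∈ S, c s ≠ 0 ∧ StrictMono s.1 ∧ StrictMono s.2 ∧ s.2 ≤ s.1 ∧
        s.2 ≤ u ∧ s.2 ≤ v ∧ u ≤ s.1 ∧ v ≤ s.1) ∧
      (u ⊔ v, u ⊓ v) ∈ S ∧ c (u ⊔ v, u ⊓ v) = 1 := by
  classical
  obtain ⟨S, c, hS, hstd, hc⟩ : ∃ (S : Finset ((Fin r → Fin n) × (Fin r → Fin n)))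
      (c : (Fin r → Fin n) × (Fin r → Fin n) → K),
      pluecker K u * pluecker K v = ∑ s ∈ S, c s • (pluecker K s.1 * pluecker K s.2) ∧
      (∀ s ∈ S, StrictMono s.1 ∧ StrictMono s.2 ∧ s.2 ≤ s.1) ∧ ∀ s, s ∈ S ↔ c s ≠ 0 := by
    let A : Set ((Fin r → Fin n) × (Fin r → Fin n)) :=
      {s | StrictMono s.1 ∧ StrictMono s.2 ∧ s.2 ≤ s.1}
    have hmem := pluecker_mul_mem_span (K := K) u v
    have himg : {f | ∃ C D : Fin r → Fin n, StrictMono C ∧ StrictMono D ∧ D ≤ C ∧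
        f = pluecker K C * pluecker K D} =
        (fun s : (Fin r → Fin n) × (Fin r → Fin n) => pluecker K s.1 * pluecker K s.2) '' A := by
      ext f
      constructor
      · rintro ⟨C, D, hC, hD, hDC, rfl⟩
        exact ⟨(C, D), ⟨hC, hD, hDC⟩, rfl⟩
      · rintro ⟨s, ⟨hC, hD, hDC⟩, rfl⟩
        exact ⟨_, _, hC, hD, hDC, rfl⟩
    rw [himg, Finsupp.mem_span_image_iff_linearCombination] at hmem
    obtain ⟨l, hl, h⟩ := hmem
    refine ⟨l.support, l, ?_, fun s hs => hl hs, fun s => Finsupp.mem_support_iff⟩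
    rw [← h, Finsupp.linearCombination_apply]
    rfl
  have hle : ∀ s ∈ S, diagWeight u v ≤ diagWeight s.1 s.2 := by
    intro s hs
    obtain ⟨w, hws, hw⟩ := (S.finite_toSet.image fun s => diagWeight s.1 s.2).exists_le_minimal
      (Set.mem_image_of_mem _ hs)
    obtain ⟨⟨t, ht, rfl⟩, hmin⟩ := hw
    refine le_trans (fun p => ?_) hws
    beta_reduce
    rw [← monomialWeight_diag p t.1]
    refine diagWeight_le_of_coeff_ne_zero (K := K) hu hv ?_ p
    rw [hS, MvPolynomial.coeff_sum, Finset.sum_eq_single t]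
    · rw [MvPolynomial.coeff_smul, coeff_diag_pluecker_mul (hstd t ht).1 (hstd t ht).2.1,
        smul_eq_mul, mul_one]
      exact (hc t).mp ht
    · intro q hq hqt
      by_contra hne
      rw [MvPolynomial.coeff_smul] at hne
      have h1 : diagWeight q.1 q.2 ≤ diagWeight t.1 t.2 := fun p => by
        rw [← monomialWeight_diag p t.1]
        exact diagWeight_le_of_coeff_ne_zero (K := K) (hstd q hq).1 (hstd q hq).2.1
          (right_ne_zero_of_smul hne) p
      have h2 := hmin (Set.mem_image_of_mem _ hq) h1
      have h3 := eq_of_diagWeight_eq (hstd q hq).1 (hstd q hq).2.1 (hstd q hq).2.2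
        (hstd t ht).1 (hstd t ht).2.1 (hstd t ht).2.2 (le_antisymm h1 h2)
      exact hqt (Prod.ext h3.1 h3.2)
    · exact fun h => absurd ht h
  have hsup : StrictMono (u ⊔ v) := fun i j hij => max_lt_max (hu hij) (hv hij)
  have hinf : StrictMono (u ⊓ v) := fun i j hij => min_lt_min (hu hij) (hv hij)
  have hwt : diagWeight (u ⊔ v) (u ⊓ v) = diagWeight u v := by
    ext p
    rw [← monomialWeight_diag, permExponent_sup_add_inf, monomialWeight_diag]
  have h1 : c (u ⊔ v, u ⊓ v) = 1 := by
    have h := coeff_diag_pluecker_mul (K := K) hu hv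
    rw [hS, MvPolynomial.coeff_sum, Finset.sum_eq_single (u ⊔ v, u ⊓ v)] at h
    · rwa [← permExponent_sup_add_inf, MvPolynomial.coeff_smul, coeff_diag_pluecker_mul hsup hinf,
        smul_eq_mul, mul_one] at h
    · intro q hq hqt
      by_contra hne
      rw [MvPolynomial.coeff_smul] at hne
      have h1 : diagWeight q.1 q.2 ≤ diagWeight u v := fun p => by
        rw [← monomialWeight_diag p u]
        exact diagWeight_le_of_coeff_ne_zero (K := K) (hstd q hq).1 (hstd q hq).2.1
          (right_ne_zero_of_smul hne) p
      have h3 := eq_of_diagWeight_eq (hstd q hq).1 (hstd q hq).2.1 (hstd q hq).2.2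
        hsup hinf inf_le_sup ((le_antisymm h1 (hle q hq)).trans hwt.symm)
      exact hqt (Prod.ext h3.1 h3.2)
    · intro hq
      rw [hc, not_not] at hq
      rw [hq, zero_smul, MvPolynomial.coeff_zero]
  refine ⟨S, c, hS, fun s hs => ?_, ?_, h1⟩
  · have := hstd s hs
    exact ⟨(hc s).mp hs, this.1, this.2.1, this.2.2,
      le_of_diagWeight_le this.1 this.2.1 this.2.2 (hle s hs)⟩
  · rw [hc, h1]
    exact one_ne_zero

end Weights

section Counting

/-- The number of entries of `f` below `j`. -/
def countBelow {s N : ℕ} (f : Fin s → Fin N) (j : ℕ) : ℕ :=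
  (Finset.univ.filter fun i => (f i : ℕ) < j).card

variable {s s' s'' N : ℕ} {f : Fin s → Fin N} {g : Fin s' → Fin N} {h : Fin s'' → Fin N}

theorem lt_countBelow_iff (hf : StrictMono f) (i : Fin s) (j : ℕ) :
    (i : ℕ) < countBelow f j ↔ (f i : ℕ) < j := by
  constructor
  · intro hi
    by_contra! hj
    have : (Finset.univ.filter fun i => (f i : ℕ) < j) ⊆ Finset.Iio i := by
      intro l hl
      have hl' : f l < f i := Fin.lt_def.mpr ((Finset.mem_filter.mp hl).2.trans_le hj)
      exact Finset.mem_Iio.mpr (hf.lt_iff_lt.mp hl')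
    have := Finset.card_le_card this
    rw [Fin.card_Iio] at this
    exact absurd hi this.not_gt
  · intro hj
    have : Finset.Iic i ⊆ (Finset.univ.filter fun i => (f i : ℕ) < j) := by
      intro l hl
      refine Finset.mem_filter.mpr ⟨Finset.mem_univ l, lt_of_le_of_lt ?_ hj⟩
      exact hf.monotone (Finset.mem_Iic.mp hl)
    have := Finset.card_le_card this
    rwa [Fin.card_Iic] at this

theorem countBelow_le (f : Fin s → Fin N) (j : ℕ) : countBelow f j ≤ s :=
  (Finset.card_filter_le _ _).trans (by simp)

theorem countBelow_top (f : Fin s → Fin N) : countBelow f N = s := by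
  simp [countBelow]

theorem countBelow_antitone {u v : Fin s → Fin N} (huv : u ≤ v) (j : ℕ) :
    countBelow v j ≤ countBelow u j :=
  Finset.card_le_card fun i hi => Finset.mem_filter.mpr
    ⟨Finset.mem_univ i, lt_of_le_of_lt (Fin.le_def.mp (huv i)) (Finset.mem_filter.mp hi).2⟩

theorem countBelow_sup {u v : Fin s → Fin N} (hu : StrictMono u) (hv : StrictMono v) (j : ℕ) :
    countBelow (u ⊔ v) j = min (countBelow u j) (countBelow v j) := by
  have huv : StrictMono (u ⊔ v) := fun a b hab => max_lt_max (hu hab) (hv hab)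
  have key : ∀ i : Fin s, (i : ℕ) < countBelow (u ⊔ v) j ↔
      (i : ℕ) < min (countBelow u j) (countBelow v j) := fun i => by
    rw [lt_min_iff, lt_countBelow_iff hu, lt_countBelow_iff hv, lt_countBelow_iff huv,
      Pi.sup_apply, Fin.coe_max, max_lt_iff]
  have h1 := countBelow_le (u ⊔ v) j
  have h2 := countBelow_le u j
  by_contra hne
  rcases Nat.lt_or_gt_of_ne hne with hlt | hlt
  · exact lt_irrefl _ ((key ⟨countBelow (u ⊔ v) j, by omega⟩).mpr hlt)
  · exact lt_irrefl _
      ((key ⟨min (countBelow u j) (countBelow v j), by omega⟩).mp hlt)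

theorem countBelow_inf {u v : Fin s → Fin N} (hu : StrictMono u) (hv : StrictMono v) (j : ℕ) :
    countBelow (u ⊓ v) j = max (countBelow u j) (countBelow v j) := by
  have huv : StrictMono (u ⊓ v) := fun a b hab => min_lt_min (hu hab) (hv hab)
  have key : ∀ i : Fin s, (i : ℕ) < countBelow (u ⊓ v) j ↔
      (i : ℕ) < max (countBelow u j) (countBelow v j) := fun i => by
    rw [lt_max_iff, lt_countBelow_iff hu, lt_countBelow_iff hv, lt_countBelow_iff huv,
      Pi.inf_apply, Fin.coe_min, min_lt_iff]
  have h1 := countBelow_le (u ⊓ v) j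
  have h2 := countBelow_le u j
  have h3 := countBelow_le v j
  by_contra hne
  rcases Nat.lt_or_gt_of_ne hne with hlt | hlt
  · exact lt_irrefl _ ((key ⟨countBelow (u ⊓ v) j, by omega⟩).mpr hlt)
  · exact lt_irrefl _
      ((key ⟨max (countBelow u j) (countBelow v j), by omega⟩).mp hlt)

theorem geTup_of_countBelow_le (hf : StrictMono f) (hg : StrictMono g)
    (hfg : ∀ j ≤ N, countBelow f j ≤ countBelow g j) : geTup f g := by
  have hs : s ≤ s' := by simpa [countBelow_top] using hfg N le_rfl
  refine ⟨hs, fun i => ?_⟩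
  have h1 := (lt_countBelow_iff hf i (f i + 1)).mpr (Nat.lt_succ_self _)
  have h2 := h1.trans_le (hfg (f i + 1) (f i).2)
  exact Fin.le_def.mpr
    (Nat.lt_succ_iff.mp ((lt_countBelow_iff hg (Fin.castLE hs i) _).mp h2))

theorem tupJoinEq_of_countBelow (hf : StrictMono f) (hg : StrictMono g) (hh : StrictMono h)
    (H : ∀ j ≤ N, countBelow h j = min (countBelow f j) (countBelow g j)) :
    tupJoinEq f g h := by
  refine ⟨by simpa [countBelow_top] using H N le_rfl, fun j hj hjf hjg => ?_⟩
  have key : ∀ a ≤ N, (h ⟨j, hj⟩ : ℕ) < a ↔ max (f ⟨j, hjf⟩ : ℕ) (g ⟨j, hjg⟩) < a := by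
    intro a ha
    rw [← lt_countBelow_iff hh, H a ha, lt_min_iff, max_lt_iff, ← lt_countBelow_iff hf,
      ← lt_countBelow_iff hg]
  have h1 := key (h ⟨j, hj⟩ + 1) (h ⟨j, hj⟩).2
  have h2 := key (max (f ⟨j, hjf⟩ : ℕ) (g ⟨j, hjg⟩) + 1)
    (max_lt (f ⟨j, hjf⟩).2 (g ⟨j, hjg⟩).2)
  omega

theorem tupMeetEq_of_countBelow (hf : StrictMono f) (hg : StrictMono g) (hh : StrictMono h)
    (H : ∀ j ≤ N, countBelow h j = max (countBelow f j) (countBelow g j)) :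
    tupMeetEq f g h := by
  refine ⟨by simpa [countBelow_top] using H N le_rfl, fun j hj hjf hjg => ?_,
    fun j hj hjf hjg => ?_, fun j hj hjg hjf => ?_⟩
  · have key : ∀ a ≤ N, (h ⟨j, hj⟩ : ℕ) < a ↔ min (f ⟨j, hjf⟩ : ℕ) (g ⟨j, hjg⟩) < a := by
      intro a ha
      rw [← lt_countBelow_iff hh, H a ha, lt_max_iff, min_lt_iff, ← lt_countBelow_iff hf,
        ← lt_countBelow_iff hg]
    have h1 := key (h ⟨j, hj⟩ + 1) (h ⟨j, hj⟩).2
    have h2 := key (min (f ⟨j, hjf⟩ : ℕ) (g ⟨j, hjg⟩) + 1)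
      (lt_of_le_of_lt (min_le_left _ _) (f ⟨j, hjf⟩).2)
    omega
  · have key : ∀ a ≤ N, (h ⟨j, hj⟩ : ℕ) < a ↔ (f ⟨j, hjf⟩ : ℕ) < a := by
      intro a ha
      have := countBelow_le g a
      rw [← lt_countBelow_iff hh, H a ha, ← lt_countBelow_iff hf]
      simp only
      omega
    have h1 := key (h ⟨j, hj⟩ + 1) (h ⟨j, hj⟩).2
    have h2 := key (f ⟨j, hjf⟩ + 1) (f ⟨j, hjf⟩).2
    omega
  · have key : ∀ a ≤ N, (h ⟨j, hj⟩ : ℕ) < a ↔ (g ⟨j, hjg⟩ : ℕ) < a := by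
      intro a ha
      have := countBelow_le f a
      rw [← lt_countBelow_iff hh, H a ha, ← lt_countBelow_iff hg]
      simp only
      omega
    have h1 := key (h ⟨j, hj⟩ + 1) (h ⟨j, hj⟩).2
    have h2 := key (g ⟨j, hjg⟩ + 1) (g ⟨j, hjg⟩).2
    omega

theorem sum_countBelow_add_sum (f : Fin s → Fin N) :
    ∑ j ∈ Finset.range (N + 1), countBelow f j + ∑ i, (f i : ℕ) = s * N := by
  have h1 : ∑ j ∈ Finset.range (N + 1), countBelow f j = ∑ i, (N - (f i : ℕ)) := by
    simp only [countBelow, Finset.card_filter]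
    rw [Finset.sum_comm]
    refine Finset.sum_congr rfl fun i _ => ?_
    rw [← Finset.card_filter]
    have : (Finset.range (N + 1)).filter (fun j => (f i : ℕ) < j) = Finset.Ioc (f i : ℕ) N := by
      ext j
      simp only [Finset.mem_filter, Finset.mem_range, Finset.mem_Ioc]
      omega
    rw [this, Nat.card_Ioc]
  rw [h1, ← Finset.sum_add_distrib, Finset.sum_congr rfl fun i _ => Nat.sub_add_cancel (f i).2.le]
  simp

theorem countBelow_append {t : ℕ} (f : Fin s → Fin N) (k : Fin t → Fin N) (j : ℕ) :
    countBelow (Fin.append f k) j = countBelow f j + countBelow k j := by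
  simp only [countBelow, Finset.card_filter, Fin.sum_univ_add, Fin.append_left, Fin.append_right]

end Counting

section SignOfShuffle

variable {s t : ℕ}

/-- The permutation listing `f` and then `k`, when these are complementary. -/
noncomputable def shufflePerm (f : Fin s → Fin (s + t)) (k : Fin t → Fin (s + t))
    (hf : Function.Injective f) (hk : Function.Injective k) (hfk : ∀ i l, f i ≠ k l) :
    Equiv.Perm (Fin (s + t)) :=
  Equiv.ofBijective (Fin.append f k)
    (Finite.injective_iff_bijective.mp (Fin.append_injective_iff.mpr ⟨hf, hk, hfk⟩))

theorem sign_shufflePerm {f : Fin s → Fin (s + t)} {k : Fin t → Fin (s + t)}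
    (hf : StrictMono f) (hk : StrictAnti k) (hfk : ∀ i l, f i ≠ k l) :
    Equiv.Perm.sign (shufflePerm f k hf.injective hk.injective hfk) =
      (-1) ^ (∑ i, (f i : ℕ) + ∑ i : Fin s, (i : ℕ) + ∑ l : Fin t, (l : ℕ)) := by
  set ρ := shufflePerm f k hf.injective hk.injective hfk with hρ
  have hl : ∀ i, ρ (Fin.castAdd t i) = f i := fun i => Fin.append_left f k i
  have hr : ∀ l, ρ (Fin.natAdd s l) = k l := fun l => Fin.append_right f k l
  have h1 : ∀ i, ∏ j ∈ Finset.Ioi i, (if ρ i < ρ j then (1 : ℤˣ) else -1) =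
      (-1) ^ ((Finset.Ioi i).filter fun j => ¬ ρ i < ρ j).card := fun i => by
    rw [Finset.prod_ite, Finset.prod_const_one, one_mul, Finset.prod_const]
  rw [Equiv.Perm.sign_eq_prod_prod_Ioi, Finset.prod_congr rfl fun i _ => h1 i, Fin.prod_univ_add,
    pow_add, pow_add]
  have hleft : ∀ i : Fin s, ((-1 : ℤˣ)) ^ ((Finset.Ioi (Fin.castAdd t i)).filter
      fun j => ¬ ρ (Fin.castAdd t i) < ρ j).card = (-1) ^ (f i : ℕ) * (-1) ^ (i : ℕ) := by
    intro i
    have hcount : ((Finset.Ioi (Fin.castAdd t i)).filter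
        fun j => ¬ ρ (Fin.castAdd t i) < ρ j).card + i = f i := by
      have e1 : (Finset.univ.filter fun j => ρ j < f i).card = f i := by
        rw [← Fin.card_Iio (f i), ← Finset.card_map ρ.toEmbedding]
        congr 1
        ext a
        simp only [Finset.mem_map, Finset.mem_filter, Finset.mem_univ, true_and, Finset.mem_Iio]
        constructor
        · rintro ⟨j, hj, rfl⟩
          exact hj
        · exact fun ha => ⟨ρ.symm a, by simpa using ha, by simp⟩
      have e2 : (Finset.univ.filter fun j => ρ j < f i) =
          ((Finset.Ioi (Fin.castAdd t i)).filter fun j => ¬ ρ (Fin.castAdd t i) < ρ j) ∪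
            Finset.Iio (Fin.castAdd t i) := by
        ext j
        simp only [Finset.mem_filter, Finset.mem_univ, true_and, Finset.mem_union,
          Finset.mem_Ioi, Finset.mem_Iio, hl]
        rcases lt_trichotomy j (Fin.castAdd t i) with hj | hj | hj
        · have : ρ j < f i := by
            induction j using Fin.addCases with
            | left j =>
              rw [hl]
              exact hf (Fin.lt_def.mpr (Fin.lt_def.mp hj))
            | right l =>
              rw [Fin.lt_def] at hj
              simp at hj
              omega
          simp [this, hj]
        · simp [hj, hl]
        · have hne : f i ≠ ρ j := fun h => hj.ne (ρ.injective ((hl i).trans h))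
          simp only [hj, true_and, hj.not_gt, or_false, not_lt]
          exact ⟨le_of_lt, fun h => lt_of_le_of_ne h hne.symm⟩
      rw [e2, Finset.card_union_of_disjoint, Fin.card_Iio, Fin.val_castAdd] at e1
      · exact e1
      · rw [Finset.disjoint_left]
        intro j hj hj'
        exact lt_asymm (Finset.mem_Ioi.mp (Finset.mem_filter.mp hj).1) (Finset.mem_Iio.mp hj')
    rw [← hcount, pow_add, mul_assoc, ← pow_add, Even.neg_one_pow ⟨_, rfl⟩, mul_one]
  have hright : ∀ l : Fin t, ((-1 : ℤˣ)) ^ ((Finset.Ioi (Fin.natAdd s l)).filter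
      fun j => ¬ ρ (Fin.natAdd s l) < ρ j).card = (-1) ^ (Fin.rev l : ℕ) := by
    intro l
    congr 1
    rw [Finset.filter_true_of_mem, Fin.card_Ioi, Fin.val_natAdd, Fin.val_rev]
    · omega
    · intro j hj
      rw [Finset.mem_Ioi] at hj
      induction j using Fin.addCases with
      | left j =>
        rw [Fin.lt_def] at hj
        simp at hj
        omega
      | right m =>
        rw [hr, hr, not_lt]
        exact (hk (by simpa using hj)).le
  rw [Finset.prod_congr rfl fun i _ => hleft i, Finset.prod_congr rfl fun l _ => hright l,
    Finset.prod_mul_distrib, Finset.prod_pow_eq_pow_sum, Finset.prod_pow_eq_pow_sum,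
    Finset.prod_pow_eq_pow_sum]
  congr 2
  exact Equiv.sum_comp Fin.revPerm fun l : Fin t => (l : ℕ)

end SignOfShuffle

section ColumnSets

variable {r d : ℕ}

theorem countBelow_perm {N : ℕ} (ρ : Equiv.Perm (Fin N)) {j : ℕ} (hj : j ≤ N) :
    countBelow ρ j = j := by
  rw [countBelow, Finset.card_filter,
    Equiv.sum_comp ρ fun a : Fin N => if (a : ℕ) < j then 1 else 0, ← Finset.card_filter,
    Fin.card_filter_val_lt, min_eq_right hj]

theorem exists_strictAnti_complement {s t : ℕ} {f : Fin s → Fin (s + t)}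
    (hf : Function.Injective f) :
    ∃ k : Fin t → Fin (s + t), StrictAnti k ∧ ∀ a, a ∈ Set.range k ↔ a ∉ Set.range f := by
  classical
  have hcard : ((Finset.univ.image f)ᶜ).card = t := by
    rw [Finset.card_compl, Finset.card_image_of_injective _ hf]
    simp
  refine ⟨fun l => Finset.orderEmbOfFin _ hcard (Fin.rev l), fun a b hab =>
    (Finset.orderEmbOfFin _ hcard).strictMono (Fin.rev_lt_rev.mpr hab), fun a => ?_⟩
  have hrange : Set.range (fun l => Finset.orderEmbOfFin _ hcard (Fin.rev l)) =
      Set.range (Finset.orderEmbOfFin _ hcard) :=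
    Fin.rev_surjective.range_comp (Finset.orderEmbOfFin _ hcard)
  rw [hrange, Finset.range_orderEmbOfFin]
  simp

/-- The columns of `(X | J)`, with `J` the antidiagonal unit matrix, whose maximal minor is the
minor of `X` indexed by `x`, up to sign. -/
def IsColumnSet (x : PairIx r d) (C : Fin r → Fin (d + r)) : Prop :=
  StrictMono C ∧ (∀ b, Fin.castAdd r b ∈ Set.range C ↔ b ∈ Set.range x.cols) ∧
    ∀ a, Fin.natAdd d (Fin.rev a) ∈ Set.range C ↔ a ∉ Set.range x.rows

theorem PairIx.size_le (x : PairIx r d) : x.s ≤ r := by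
  simpa using Fintype.card_le_of_injective _ x.rmono.injective

theorem IsColumnSet.unique {x : PairIx r d} {C C' : Fin r → Fin (d + r)}
    (h : IsColumnSet x C) (h' : IsColumnSet x C') : C = C' := by
  refine (StrictMono.range_inj h.1 h'.1).mp (Set.ext fun e => ?_)
  induction e using Fin.addCases with
  | left b => rw [h.2.1, h'.2.1]
  | right e =>
    have h1 := h.2.2 (Fin.rev e)
    have h2 := h'.2.2 (Fin.rev e)
    rw [Fin.rev_rev] at h1 h2
    rw [h1, h2]

theorem isColumnSet_append {s t : ℕ} {A : Fin s → Fin (s + t)} {B : Fin s → Fin d}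
    (hA : StrictMono A) (hB : StrictMono B) {k : Fin t → Fin (s + t)} (hk : StrictAnti k)
    (hkA : ∀ a, a ∈ Set.range k ↔ a ∉ Set.range A) :
    IsColumnSet ⟨s, A, B, hA, hB⟩
      (Fin.append (fun i => Fin.castAdd (s + t) (B i)) fun l => Fin.natAdd d (Fin.rev (k l))) := by
  refine ⟨fun i j hij => ?_, fun b => ?_, fun a => ?_⟩
  · rw [Fin.lt_def] at hij ⊢
    induction i using Fin.addCases with
    | left i =>
      induction j using Fin.addCases with
      | left j => simpa using Fin.lt_def.mp (hB (Fin.lt_def.mpr hij))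
      | right m =>
        simp only [Fin.append_left, Fin.append_right, Fin.val_castAdd, Fin.val_natAdd]
        have := (B i).2
        omega
    | right l =>
      induction j using Fin.addCases with
      | left j =>
        simp only [Fin.val_castAdd, Fin.val_natAdd] at hij
        omega
      | right m =>
        have hlm : l < m := by
          rw [Fin.lt_def]
          simpa using hij
        simpa using Fin.lt_def.mp (Fin.rev_lt_rev.mpr (hk hlm))
  · simp only [Set.mem_range]
    constructor
    · rintro ⟨i, hi⟩
      induction i using Fin.addCases with
      | left i =>
        rw [Fin.append_left] at hi
        exact ⟨i, Fin.castAdd_injective _ _ hi⟩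
      | right l =>
        rw [Fin.append_right, Fin.ext_iff, Fin.val_natAdd, Fin.val_castAdd] at hi
        have := b.2
        omega
    · rintro ⟨i, rfl⟩
      exact ⟨Fin.castAdd t i, Fin.append_left _ _ i⟩
  · rw [← hkA]
    simp only [Set.mem_range]
    constructor
    · rintro ⟨i, hi⟩
      induction i using Fin.addCases with
      | left i =>
        rw [Fin.append_left, Fin.ext_iff, Fin.val_natAdd, Fin.val_castAdd] at hi
        have := (B i).2
        omega
      | right l =>
        rw [Fin.append_right] at hi
        exact ⟨l, Fin.rev_injective (Fin.natAdd_injective _ _ hi)⟩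
    · rintro ⟨l, rfl⟩
      exact ⟨Fin.natAdd s l, Fin.append_right _ _ l⟩

theorem exists_isColumnSet (x : PairIx r d) : ∃ C, IsColumnSet x C := by
  have hs := x.size_le
  obtain ⟨s, A, B, hA, hB⟩ := x
  obtain ⟨t, rfl⟩ : ∃ t, r = s + t := Nat.exists_eq_add_of_le hs
  obtain ⟨k, hk, hkA⟩ := exists_strictAnti_complement hA.injective
  exact ⟨_, isColumnSet_append hA hB hk hkA⟩

theorem exists_pairIx_isColumnSet {C : Fin r → Fin (d + r)} (hC : StrictMono C) :
    ∃ x, IsColumnSet x C := by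
  classical
  set cols := Finset.univ.filter fun b : Fin d => Fin.castAdd r b ∈ Set.range C with hcols
  set rows := Finset.univ.filter fun a : Fin r =>
    ¬ Fin.natAdd d (Fin.rev a) ∈ Set.range C with hrows
  have hcard : rows.card = cols.card := by
    have h1 : (Finset.univ.filter fun e : Fin (d + r) => e ∈ Set.range C).card = r := by
      have : (Finset.univ.filter fun e : Fin (d + r) => e ∈ Set.range C) =
          Finset.univ.image C := by
        ext e
        simp
      rw [this, Finset.card_image_of_injective _ hC.injective, Finset.card_univ, Fintype.card_fin]
    rw [Finset.card_filter, Fin.sum_univ_add, ← Finset.card_filter, ← hcols,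
      ← Equiv.sum_comp Fin.revPerm, ← Finset.card_filter] at h1
    have h2 := Finset.card_filter_add_card_filter_not (s := (Finset.univ : Finset (Fin r)))
      fun a => Fin.natAdd d (Fin.rev a) ∈ Set.range C
    rw [← hrows, Finset.card_univ, Fintype.card_fin] at h2
    simp only [Fin.revPerm_apply] at h1
    omega
  refine ⟨⟨cols.card, rows.orderEmbOfFin hcard, cols.orderEmbOfFin rfl,
    OrderEmbedding.strictMono _, OrderEmbedding.strictMono _⟩, hC, fun b => ?_, fun a => ?_⟩
  · simp only [Finset.range_orderEmbOfFin]
    simp [hcols]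
  · simp only [Finset.range_orderEmbOfFin]
    simp [hrows]

theorem IsColumnSet.exists_eq_append {s t : ℕ} {A : Fin s → Fin (s + t)} {B : Fin s → Fin d}
    {hA : StrictMono A} {hB : StrictMono B} {C : Fin (s + t) → Fin (d + (s + t))}
    (h : IsColumnSet ⟨s, A, B, hA, hB⟩ C) :
    ∃ k : Fin t → Fin (s + t), StrictAnti k ∧ (∀ i l, A i ≠ k l) ∧
      C = Fin.append (fun i => Fin.castAdd (s + t) (B i)) fun l => Fin.natAdd d (Fin.rev (k l)) := by
  obtain ⟨k, hk, hkA⟩ := exists_strictAnti_complement hA.injective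
  exact ⟨k, hk, fun i l hil => (hkA (k l)).mp ⟨l, rfl⟩ ⟨i, hil⟩,
    h.unique (isColumnSet_append hA hB hk hkA)⟩

theorem IsColumnSet.countBelow_cols {x : PairIx r d} {C : Fin r → Fin (d + r)}
    (h : IsColumnSet x C) {j : ℕ} (hj : j ≤ d) : countBelow C j = countBelow x.cols j := by
  have hs := x.size_le
  obtain ⟨s, A, B, hA, hB⟩ := x
  obtain ⟨t, rfl⟩ : ∃ t, r = s + t := Nat.exists_eq_add_of_le hs
  obtain ⟨k, hk, hkA, rfl⟩ := h.exists_eq_append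
  rw [countBelow_append, add_eq_left.mpr]
  · rfl
  · rw [countBelow, Finset.card_eq_zero, Finset.filter_eq_empty_iff]
    intro l _
    rw [Fin.val_natAdd]
    omega

theorem IsColumnSet.countBelow_rows {x : PairIx r d} {C : Fin r → Fin (d + r)}
    (h : IsColumnSet x C) {j : ℕ} (hj : j ≤ r) :
    countBelow C (d + (r - j)) = (r - j) + countBelow x.rows j := by
  have hs := x.size_le
  obtain ⟨s, A, B, hA, hB⟩ := x
  obtain ⟨t, rfl⟩ : ∃ t, r = s + t := Nat.exists_eq_add_of_le hs
  obtain ⟨k, hk, hkA, rfl⟩ := h.exists_eq_append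
  have h1 := countBelow_perm (shufflePerm A k hA.injective hk.injective hkA) hj
  have h2 : countBelow (shufflePerm A k hA.injective hk.injective hkA) j =
    countBelow A j + countBelow k j := countBelow_append A k j
  have h3 : countBelow (fun i => Fin.castAdd (s + t) (B i)) (d + (s + t - j)) = s := by
    rw [countBelow, Finset.filter_true_of_mem, Finset.card_univ, Fintype.card_fin]
    intro i _
    have := (B i).2
    rw [Fin.val_castAdd]
    omega
  have h4 : countBelow (fun l => Fin.natAdd d (Fin.rev (k l))) (d + (s + t - j)) +
      countBelow k j = t := by
    rw [countBelow, countBelow, add_comm]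
    convert Finset.card_filter_add_card_filter_not (s := (Finset.univ : Finset (Fin t)))
      (fun l => (k l : ℕ) < j) using 3
    · refine Finset.filter_congr fun l _ => ?_
      have := (k l).2
      rw [Fin.val_natAdd, Fin.val_rev]
      omega
    · simp
  rw [countBelow_append, h3]
  change s + _ = s + t - j + countBelow A j
  omega

theorem IsColumnSet.geTup {x y : PairIx r d} {C D : Fin r → Fin (d + r)} (hx : IsColumnSet x C)
    (hy : IsColumnSet y D) (hDC : D ≤ C) : geTup x.rows y.rows ∧ geTup x.cols y.cols := by
  refine ⟨geTup_of_countBelow_le x.rmono y.rmono fun j hj => ?_,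
    geTup_of_countBelow_le x.cmono y.cmono fun j hj => ?_⟩
  · have h := countBelow_antitone hDC (d + (r - j))
    rw [hx.countBelow_rows hj, hy.countBelow_rows hj] at h
    exact Nat.add_le_add_iff_left.mp h
  · have h := countBelow_antitone hDC j
    rwa [hx.countBelow_cols hj, hy.countBelow_cols hj] at h

theorem IsColumnSet.countBelow_rows_sup {x y z : PairIx r d} {C D : Fin r → Fin (d + r)}
    (hz : IsColumnSet z (C ⊔ D)) (hx : IsColumnSet x C) (hy : IsColumnSet y D) :
    ∀ j ≤ r, countBelow z.rows j = min (countBelow x.rows j) (countBelow y.rows j) := by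
  intro j hj
  have h := countBelow_sup hx.1 hy.1 (d + (r - j))
  rw [hz.countBelow_rows hj, hx.countBelow_rows hj, hy.countBelow_rows hj] at h
  omega

theorem IsColumnSet.countBelow_rows_inf {x y z : PairIx r d} {C D : Fin r → Fin (d + r)}
    (hz : IsColumnSet z (C ⊓ D)) (hx : IsColumnSet x C) (hy : IsColumnSet y D) :
    ∀ j ≤ r, countBelow z.rows j = max (countBelow x.rows j) (countBelow y.rows j) := by
  intro j hj
  have h := countBelow_inf hx.1 hy.1 (d + (r - j))
  rw [hz.countBelow_rows hj, hx.countBelow_rows hj, hy.countBelow_rows hj] at h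
  omega

/-- The exponent of the sign relating a minor of `X` to a maximal minor of `(X | J)`. -/
def signExponent (x : PairIx r d) : ℕ :=
  ∑ i, (x.rows i : ℕ) + ∑ i ∈ Finset.range x.s, i + ∑ l ∈ Finset.range (r - x.s), l

theorem signExponent_add {x y z w : PairIx r d}
    (hz : ∀ j ≤ r, countBelow z.rows j = min (countBelow x.rows j) (countBelow y.rows j))
    (hw : ∀ j ≤ r, countBelow w.rows j = max (countBelow x.rows j) (countBelow y.rows j)) :
    signExponent z + signExponent w = signExponent x + signExponent y := by
  have hzs : z.s = min x.s y.s := by simpa [countBelow_top] using hz r le_rfl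
  have hws : w.s = max x.s y.s := by simpa [countBelow_top] using hw r le_rfl
  have hsize : ∀ F : ℕ → ℕ, F z.s + F w.s = F x.s + F y.s := by
    intro F
    rw [hzs, hws]
    rcases le_total x.s y.s with h | h
    · rw [min_eq_left h, max_eq_right h]
    · rw [min_eq_right h, max_eq_left h, add_comm]
  have hcount : ∑ j ∈ Finset.range (r + 1), countBelow z.rows j +
      ∑ j ∈ Finset.range (r + 1), countBelow w.rows j =
      ∑ j ∈ Finset.range (r + 1), countBelow x.rows j +
      ∑ j ∈ Finset.range (r + 1), countBelow y.rows j := by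
    rw [← Finset.sum_add_distrib, ← Finset.sum_add_distrib]
    refine Finset.sum_congr rfl fun j hj => ?_
    have hj' := Nat.lt_succ_iff.mp (Finset.mem_range.mp hj)
    rw [hz j hj', hw j hj', min_add_max]
  have h1 := sum_countBelow_add_sum x.rows
  have h2 := sum_countBelow_add_sum y.rows
  have h3 := sum_countBelow_add_sum z.rows
  have h4 := sum_countBelow_add_sum w.rows
  have h5 := hsize fun s => s * r
  have h6 := hsize fun s => ∑ i ∈ Finset.range s, i
  have h7 := hsize fun s => ∑ i ∈ Finset.range (r - s), i
  unfold signExponent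
  omega

/-- Specialization of a generic `r × (d + r)` matrix to `(X | J)`, with `J` the antidiagonal unit
matrix. -/
noncomputable def toGenericAlgHom (K : Type) [Field K] (r d : ℕ) :
    MvPolynomial (Fin r × Fin (d + r)) K →ₐ[K] KZ K r d :=
  MvPolynomial.aeval fun p =>
    Fin.addCases (fun b => MvPolynomial.X (p.1, b)) (fun e => if p.1 = Fin.rev e then 1 else 0) p.2

theorem toGenericAlgHom_pluecker (K : Type) [Field K] {x : PairIx r d} {C : Fin r → Fin (d + r)}
    (h : IsColumnSet x C) :
    toGenericAlgHom K r d (pluecker K C) = (-1 : K) ^ signExponent x • minorPoly K r d x := by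
  have hs := x.size_le
  obtain ⟨s, A, B, hA, hB⟩ := x
  obtain ⟨t, rfl⟩ : ∃ t, r = s + t := Nat.exists_eq_add_of_le hs
  obtain ⟨k, hk, hkA, rfl⟩ := h.exists_eq_append
  set C := Fin.append (fun i => Fin.castAdd (s + t) (B i)) fun l => Fin.natAdd d (Fin.rev (k l))
  set ρ := shufflePerm A k hA.injective hk.injective hkA with hρ
  have hl : ∀ i, ρ (Fin.castAdd t i) = A i := fun i => Fin.append_left A k i
  have hr : ∀ l, ρ (Fin.natAdd s l) = k l := fun l => Fin.append_right A k l
  set M := (toGenericAlgHom K (s + t) d).mapMatrix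
    (Matrix.of fun i j => (MvPolynomial.X (i, C j) : MvPolynomial _ K)) with hM
  have hMX : ∀ i j, M i (Fin.castAdd t j) = MvPolynomial.X (i, B j) := by
    intro i j
    simp [hM, C, toGenericAlgHom]
  have hMJ : ∀ i l, M i (Fin.natAdd s l) = if i = k l then 1 else 0 := by
    intro i l
    simp [hM, C, toGenericAlgHom]
  have hblock : (M.submatrix ρ id).submatrix finSumFinEquiv finSumFinEquiv =
      Matrix.fromBlocks (Matrix.of fun i j => MvPolynomial.X (A i, B j)) 0
        (Matrix.of fun l j => MvPolynomial.X (k l, B j)) 1 := by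
    ext1 i j
    rcases i with i | l <;> rcases j with j | m
    · simp [hMX, hl]
    · simp [hMJ, hl, hkA]
    · simp [hMX, hr]
    · simp [hMJ, hr, Matrix.one_apply, hk.injective.eq_iff]
  have hdet : (Equiv.Perm.sign ρ : ℤ) * M.det =
      minorPoly K (s + t) d ⟨s, A, B, hA, hB⟩ := by
    rw [← Matrix.det_permute, ← Matrix.det_submatrix_equiv_self finSumFinEquiv, hblock,
      Matrix.det_fromBlocks_zero₁₂, Matrix.det_one, mul_one]
    rfl
  have hsign : ((Equiv.Perm.sign ρ : ℤ) : KZ K (s + t) d) =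
      (-1) ^ signExponent (⟨s, A, B, hA, hB⟩ : PairIx (s + t) d) := by
    rw [hρ, sign_shufflePerm hA hk hkA, signExponent]
    simp only [Nat.add_sub_cancel_left, ← Fin.sum_univ_eq_sum_range]
    push_cast
    rfl
  rw [pluecker, AlgHom.map_det, ← hdet, hsign, MvPolynomial.smul_eq_C_mul, ← mul_assoc, map_pow,
    map_neg, map_one, ← mul_pow, neg_one_mul, neg_neg, one_pow, one_mul]

end ColumnSets

end SMB

open SMB in
/-- **Straightening relation in `K[Z]`.**
If `(A₁,A₂)` and `(B₁,B₂)` are noncomparable pairs indexing minors of the generic `r×d`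
matrix, then `p(A₁,A₂)·p(B₁,B₂)` is a finite sum `Σᵢ aᵢ p(Cᵢ₁,Cᵢ₂)p(Dᵢ₁,Dᵢ₂)` of standard
degree-2 monomials with nonzero coefficients, in which all `Cᵢ` dominate and all `Dᵢ` are
dominated by both `(A₁,A₂)` and `(B₁,B₂)` entrywise, and the term
`p((A₁,A₂)∨(B₁,B₂))·p((A₁,A₂)∧(B₁,B₂))` (join and meet taken componentwise) occurs with
coefficient `1`.  (The pair of empty tuples is allowed, `p(∅,∅)` being the constant `1`.) -/
theorem determinantal_straightening (K : Type) [Field K] [IsAlgClosed K]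
    (r d : ℕ) (x y : PairIx r d) (hx : 0 < x.s) (hy : 0 < y.s)
    (hxy : ¬ PairIx.ge x y ∧ ¬ PairIx.ge y x) :
    ∃ (T : Finset (PairIx r d × PairIx r d)) (a : PairIx r d × PairIx r d → K),
      (minorPoly K r d x * minorPoly K r d y =
        ∑ t ∈ T, a t • (minorPoly K r d t.1 * minorPoly K r d t.2)) ∧
      (∀ t ∈ T, a t ≠ 0 ∧ PairIx.ge t.1 t.2 ∧
        geTup t.1.rows x.rows ∧ geTup t.1.rows y.rows ∧
        geTup t.1.cols x.cols ∧ geTup t.1.cols y.cols ∧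
        geTup x.rows t.2.rows ∧ geTup y.rows t.2.rows ∧
        geTup x.cols t.2.cols ∧ geTup y.cols t.2.cols) ∧
      ∃ t₀ ∈ T, a t₀ = 1 ∧
        tupJoinEq x.rows y.rows t₀.1.rows ∧ tupJoinEq x.cols y.cols t₀.1.cols ∧
        tupMeetEq x.rows y.rows t₀.2.rows ∧ tupMeetEq x.cols y.cols t₀.2.cols := by
  classical
  choose u hu using exists_isColumnSet (r := r) (d := d)
  have hz : ∀ C : Fin r → Fin (d + r), ∃ z : PairIx r d, StrictMono C → IsColumnSet z C :=
    fun C => by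
      by_cases hC : StrictMono C
      · exact (exists_pairIx_isColumnSet hC).imp fun _ h _ => h
      · exact ⟨x, fun h => absurd h hC⟩
  choose z hz using hz
  have huz : ∀ C, StrictMono C → u (z C) = C := fun C hC => (hu _).unique (hz C hC)
  obtain ⟨S, c, hS, hSC, hmem, hone⟩ := pluecker_straightening (K := K) (hu x).1 (hu y).1
  have hinj : Set.InjOn
      (fun s : (Fin r → Fin (d + r)) × (Fin r → Fin (d + r)) => (z s.1, z s.2)) S := by
    intro s hs t ht hst
    obtain ⟨h1, h2⟩ := Prod.ext_iff.mp hst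
    have hs' := hSC s hs
    have ht' := hSC t ht
    simp only at h1 h2
    exact Prod.ext (by rw [← huz _ hs'.2.1, h1, huz _ ht'.2.1])
      (by rw [← huz _ hs'.2.2.1, h2, huz _ ht'.2.2.1])
  have hsq : ∀ e : ℕ, (-1 : K) ^ e * (-1) ^ e = 1 := fun e => by
    rw [← mul_pow, neg_one_mul, neg_neg, one_pow]
  refine ⟨S.image fun s => (z s.1, z s.2), fun t =>
    (-1) ^ (signExponent x + signExponent y) * (-1) ^ (signExponent t.1 + signExponent t.2) *
      c (u t.1, u t.2), ?_, ?_, ?_⟩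
  · have h := congrArg (fun p => (-1 : K) ^ (signExponent x + signExponent y) •
      toGenericAlgHom K r d p) hS
    simp only [map_mul, map_sum, map_smul, toGenericAlgHom_pluecker K (hu _), smul_mul_smul_comm,
      ← pow_add, smul_smul, hsq, one_smul] at h
    rw [h, Finset.smul_sum, Finset.sum_image hinj]
    refine Finset.sum_congr rfl fun s hs => ?_
    have hs' := hSC s hs
    simp only [huz _ hs'.2.1, huz _ hs'.2.2.1]
    rw [toGenericAlgHom_pluecker K (hz _ hs'.2.1),
      toGenericAlgHom_pluecker K (hz _ hs'.2.2.1), smul_mul_smul_comm, smul_smul, smul_smul,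
      ← pow_add]
    congr 1
    ring
  · intro t ht
    obtain ⟨s, hs, rfl⟩ := Finset.mem_image.mp ht
    obtain ⟨hc, h1, h2, h21, h2x, h2y, hx1, hy1⟩ := hSC s hs
    have hz1 := hz _ h1
    have hz2 := hz _ h2
    refine ⟨?_, (hz1.geTup hz2 h21), (hz1.geTup (hu x) hx1).1, (hz1.geTup (hu y) hy1).1,
      (hz1.geTup (hu x) hx1).2, (hz1.geTup (hu y) hy1).2, ((hu x).geTup hz2 h2x).1,
      ((hu y).geTup hz2 h2y).1, ((hu x).geTup hz2 h2x).2, ((hu y).geTup hz2 h2y).2⟩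
    simp only [huz _ h1, huz _ h2]
    exact mul_ne_zero (mul_ne_zero (pow_ne_zero _ (neg_ne_zero.mpr one_ne_zero))
      (pow_ne_zero _ (neg_ne_zero.mpr one_ne_zero))) hc
  · obtain ⟨-, hsup, hinf, -⟩ := hSC _ hmem
    have hzs := hz _ hsup
    have hzi := hz _ hinf
    have hrs := hzs.countBelow_rows_sup (hu x) (hu y)
    have hri := hzi.countBelow_rows_inf (hu x) (hu y)
    refine ⟨_, Finset.mem_image_of_mem _ hmem, ?_, ?_, ?_, ?_, ?_⟩
    · simp only [huz _ hsup, huz _ hinf, hone, mul_one]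
      rw [signExponent_add hrs hri, hsq]
    · exact tupJoinEq_of_countBelow x.rmono y.rmono (PairIx.rmono _) hrs
    · exact tupJoinEq_of_countBelow x.cmono y.cmono (PairIx.cmono _) fun j hj => by
        rw [← hzs.countBelow_cols hj, countBelow_sup (hu x).1 (hu y).1,
          (hu x).countBelow_cols hj, (hu y).countBelow_cols hj]
    · exact tupMeetEq_of_countBelow x.rmono y.rmono (PairIx.rmono _) hri
    · exact tupMeetEq_of_countBelow x.cmono y.cmono (PairIx.cmono _) fun j hj => by
        rw [← hzi.countBelow_cols hj, countBelow_inf (hu x).1 (hu y).1,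
          (hu x).countBelow_cols hj, (hu y).countBelow_cols hj]
end

section
/- Let n ≤ m and let U = (u_{ij}) be a generic m×n matrix. For I ∈ I(n,m) let u(I) ∈ K[u_{ij}] denote the n×n (maximal) minor of U with row indices I. If I, I' ∈ I(n,m) are noncomparable in the componentwise order, then there exist finitely many pairs (I_r, I'_r) ∈ I(n,m) × I(n,m) and scalars b_r ∈ K∖{0} such that u(I)u(I') = Σ_r b_r u(I_r)u(I'_r) in K[u_{ij}], where for every r the tuple I_r is componentwise ≥ both I and I', and I'_r is componentwise ≤ both I and I'. -/
namespace SMB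

variable (K : Type) [Field K] (n m : ℕ)

/-- `u(I)`: the maximal (`n×n`) minor of the generic `m×n` matrix `U` with row indices `I`. -/
noncomputable def uMin (I : IncTup n m) : MvPolynomial (Fin m × Fin n) K :=
  Matrix.det (Matrix.of fun i j : Fin n => MvPolynomial.X (I.f i, j))

end SMB

namespace SMB

section Exchange

variable {R : Type*} [CommRing R] {n : ℕ}

/-- The alternating map in the arguments indexed by `P` obtained by fixing the other arguments
of an alternating map. -/
def restrictAlternating {M : Type*} [AddCommGroup M] [Module R M]
    (f : M [⋀^Fin n]→ₗ[R] R) (P : Fin n → Prop) [DecidablePred P] (x : Fin n → M) :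
    M [⋀^{i // P i}]→ₗ[R] R :=
  { f.toMultilinearMap.domDomRestrict P (fun i => x i) with
    map_eq_zero_of_eq' := by
      intro v i j hij hne
      refine f.map_eq_zero_of_eq _ (i := i) (j := j) ?_ (fun h => hne (Subtype.ext h))
      simp [i.2, j.2, hij] }

theorem restrictAlternating_apply {M : Type*} [AddCommGroup M] [Module R M]
    (f : M [⋀^Fin n]→ₗ[R] R) (P : Fin n → Prop) [DecidablePred P] (x : Fin n → M)
    (v : {i // P i} → M) :
    restrictAlternating f P x v = f (fun i => if h : P i then v ⟨i, h⟩ else x i) := rfl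

/-- The exchange relation: a product of two alternating forms in `n` vectors of `Rⁿ` lies in any
submodule containing the products obtained by nontrivially shuffling the first `k + 1` arguments
of the first factor with the last `n - k` arguments of the second one. -/
theorem mul_mem_of_exchange [IsDomain R] (f g : (Fin n → R) [⋀^Fin n]→ₗ[R] R) (k : Fin n)
    (x y : Fin n → Fin n → R) (S : AddSubgroup R)
    (h : ∀ σ : Equiv.Perm ({i : Fin n // i ≤ k} ⊕ {i : Fin n // k ≤ i}),
      (∃ i i', σ (Sum.inl i) = Sum.inr i') →
      f (fun i => if h : i ≤ k then
          Sum.elim (fun a => x a.1) (fun b => y b.1) (σ (Sum.inl ⟨i, h⟩)) else x i) *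
        g (fun i => if h : k ≤ i then
          Sum.elim (fun a => x a.1) (fun b => y b.1) (σ (Sum.inr ⟨i, h⟩)) else y i) ∈ S) :
    f x * g y ∈ S := by
  classical
  let a := restrictAlternating f (fun i => i ≤ k) x
  let b := restrictAlternating g (fun i => k ≤ i) y
  let z : {i : Fin n // i ≤ k} ⊕ {i : Fin n // k ≤ i} → Fin n → R :=
    Sum.elim (fun a => x a.1) (fun b => y b.1)
  have hz : a.domCoprod b z = 0 := by
    refine AlternatingMap.map_linearDependent _ _ fun hli => ?_
    have := hli.fintype_card_le_finrank
    have h1 : Fintype.card {i : Fin n // i ≤ k} = k + 1 := by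
      rw [Fintype.card_subtype, ← Fin.card_Iic]; congr 1; ext; simp
    have h2 : Fintype.card {i : Fin n // k ≤ i} = n - k := by
      rw [Fintype.card_subtype, ← Fin.card_Ici]; congr 1; ext; simp
    rw [Fintype.card_sum, h1, h2, Module.finrank_fin_fun] at this
    omega
  have hsum : ∑ q, LinearMap.mul' R R (AlternatingMap.domCoprod.summand a b q z) = 0 := by
    rw [AlternatingMap.domCoprod_apply, _root_.sum_apply] at hz
    rw [← map_sum, hz, map_zero]
  have hterm : ∀ σ, LinearMap.mul' R R
      (AlternatingMap.domCoprod.summand a b (Quotient.mk'' σ) z) =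
      Equiv.Perm.sign σ • (a (fun i => z (σ (Sum.inl i))) * b (fun i => z (σ (Sum.inr i)))) := by
    intro σ
    rw [AlternatingMap.domCoprod.summand_mk'']
    rcases Int.units_eq_one_or (Equiv.Perm.sign σ) with h | h <;> simp [h]
  replace hsum := (Finset.add_sum_erase _
    (fun q => LinearMap.mul' R R (AlternatingMap.domCoprod.summand a b q z))
    (Finset.mem_univ (Quotient.mk'' 1))).trans hsum
  rw [hterm] at hsum
  simp only [Equiv.Perm.sign_one, Equiv.Perm.one_apply, one_smul] at hsum
  have ha : a (fun i => z (Sum.inl i)) = f x := by simp [a, z, restrictAlternating_apply]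
  have hb : b (fun i => z (Sum.inr i)) = g y := by simp [b, z, restrictAlternating_apply]
  rw [ha, hb] at hsum
  rw [eq_neg_of_add_eq_zero_left hsum]
  refine S.neg_mem (S.sum_mem fun q hq => ?_)
  induction q using Quotient.inductionOn' with | _ σ
  rw [hterm]
  have hσ : ∃ i i', σ (Sum.inl i) = Sum.inr i' := by
    by_contra! hcon
    refine (Finset.mem_erase.1 hq).1 ?_
    have hmem : σ ∈ (Equiv.Perm.sumCongrHom _ _).range := by
      refine Equiv.Perm.mem_sumCongrHom_range_of_perm_mapsTo_inl ?_
      rintro _ ⟨i, rfl⟩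
      rcases hi : σ (Sum.inl i) with i' | i'
      · exact ⟨i', rfl⟩
      · exact absurd hi (hcon i i')
    refine Quotient.sound' ?_
    rw [QuotientGroup.leftRel_apply]
    simpa using (Subgroup.inv_mem _ hmem)
  have := h σ hσ
  rcases Int.units_eq_one_or (Equiv.Perm.sign σ) with h' | h' <;> rw [h']
  · simpa [a, b, z, restrictAlternating_apply] using this
  · simpa [a, b, z, restrictAlternating_apply] using this

end Exchange

section Sorting

variable {n m : ℕ}

@[ext]
theorem IncTup.ext_f {A B : IncTup n m} (h : ∀ j, A.f j = B.f j) : A = B := by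
  cases A; cases B
  simpa using funext h

instance : Finite (IncTup n m) :=
  Finite.of_injective (fun A : IncTup n m => A.f) fun _ _ h => IncTup.ext_f (congrFun h)

theorem IncTup.le_of_card_le (C : IncTup n m) (π : Equiv.Perm (Fin n)) (x : Fin m) (j : Fin n)
    (h : (Finset.univ.filter fun i => C.f (π i) < x).card ≤ j) : x ≤ C.f j := by
  by_contra! hlt
  have hsub : (Finset.Iic j).map π.symm.toEmbedding ⊆
      Finset.univ.filter fun i => C.f (π i) < x := by
    intro i hi
    obtain ⟨l, hl, rfl⟩ := Finset.mem_map.1 hi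
    simpa using (C.mono.monotone (Finset.mem_Iic.1 hl)).trans_lt hlt
  have := Finset.card_le_card hsub
  rw [Finset.card_map, Fin.card_Iic] at this
  omega

theorem IncTup.ge_of_card_le (C : IncTup n m) (π : Equiv.Perm (Fin n)) (x : Fin m) (j : Fin n)
    (h : (Finset.univ.filter fun i => x < C.f (π i)).card ≤ n - 1 - j) : C.f j ≤ x := by
  by_contra! hlt
  have hsub : (Finset.Ici j).map π.symm.toEmbedding ⊆
      Finset.univ.filter fun i => x < C.f (π i) := by
    intro i hi
    obtain ⟨l, hl, rfl⟩ := Finset.mem_map.1 hi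
    simpa using hlt.trans_le (C.mono.monotone (Finset.mem_Ici.1 hl))
  have := Finset.card_le_card hsub
  rw [Finset.card_map, Fin.card_Ici] at this
  omega

theorem exists_incTup_comp_perm (α : Fin n → Fin m) (hα : Function.Injective α) :
    ∃ (C : IncTup n m) (π : Equiv.Perm (Fin n)), ∀ i, C.f (π i) = α i :=
  ⟨⟨α ∘ Tuple.sort α, (Tuple.monotone_sort α).strictMono_of_injective
    (hα.comp (Tuple.sort α).injective)⟩, (Tuple.sort α).symm, fun i => by simp⟩

variable {k : Fin n} {A B : IncTup n m}
  {σ : Equiv.Perm ({i : Fin n // i ≤ k} ⊕ {i : Fin n // k ≤ i})}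
  {C : IncTup n m} {π : Equiv.Perm (Fin n)}

theorem le_of_exchange_left (hk : A.f k < B.f k)
    (hC : ∀ i, C.f (π i) = if h : i ≤ k then
      Sum.elim (fun a => A.f a.1) (fun b => B.f b.1) (σ (Sum.inl ⟨i, h⟩)) else A.f i)
    (j : Fin n) : A.f j ≤ C.f j := by
  refine C.le_of_card_le π _ j ?_
  rw [← Fin.card_Iio]
  rcases le_or_gt j k with hj | hj
  · refine Finset.card_le_card_of_forall_subsingleton
      (fun i i' => ∃ h h', σ (Sum.inl ⟨i, h⟩) = Sum.inl ⟨i', h'⟩) ?_ ?_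
    · intro i hi
      rw [Finset.mem_filter, hC] at hi
      replace hi := hi.2
      split_ifs at hi with h
      · rcases hs : σ (Sum.inl ⟨i, h⟩) with i' | i'
        · rw [hs] at hi
          exact ⟨i', Finset.mem_Iio.2 (A.mono.lt_iff_lt.1 hi), h, i'.2, hs⟩
        · rw [hs] at hi
          have h1 := A.mono.monotone hj
          have h2 := B.mono.monotone i'.2
          simp only [Sum.elim_inr] at hi
          exact absurd (hi.trans_le (h1.trans (hk.le.trans h2))) (lt_irrefl _)
      · exact absurd (A.mono.lt_iff_lt.1 hi) (by omega)
    · rintro i' - i₁ ⟨-, h₁, h₁', e₁⟩ i₂ ⟨-, h₂, h₂', e₂⟩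
      simpa using σ.injective (e₁.trans e₂.symm)
  · refine Finset.card_le_card fun i hi => ?_
    rw [Finset.mem_filter, hC] at hi
    rw [Finset.mem_Iio]
    by_contra! hij
    have := hi.2
    rw [dif_neg (by omega), A.mono.lt_iff_lt] at this
    omega

theorem ge_of_exchange_right (hk : A.f k < B.f k)
    (hC : ∀ i, C.f (π i) = if h : k ≤ i then
      Sum.elim (fun a => A.f a.1) (fun b => B.f b.1) (σ (Sum.inr ⟨i, h⟩)) else B.f i)
    (j : Fin n) : C.f j ≤ B.f j := by
  refine C.ge_of_card_le π _ j ?_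
  rw [← Fin.card_Ioi]
  rcases le_or_gt k j with hj | hj
  · refine Finset.card_le_card_of_forall_subsingleton
      (fun i i' => ∃ h h', σ (Sum.inr ⟨i, h⟩) = Sum.inr ⟨i', h'⟩) ?_ ?_
    · intro i hi
      rw [Finset.mem_filter, hC] at hi
      replace hi := hi.2
      split_ifs at hi with h
      · rcases hs : σ (Sum.inr ⟨i, h⟩) with i' | i'
        · rw [hs] at hi
          have h1 := B.mono.monotone hj
          have h2 := A.mono.monotone i'.2
          simp only [Sum.elim_inl] at hi
          exact absurd (hi.trans_le (h2.trans (hk.le.trans h1))) (lt_irrefl _)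
        · rw [hs] at hi
          exact ⟨i', Finset.mem_Ioi.2 (B.mono.lt_iff_lt.1 hi), h, i'.2, hs⟩
      · exact absurd (B.mono.lt_iff_lt.1 hi) (by omega)
    · rintro i' - i₁ ⟨-, h₁, h₁', e₁⟩ i₂ ⟨-, h₂, h₂', e₂⟩
      simpa using σ.injective (e₁.trans e₂.symm)
  · refine Finset.card_le_card fun i hi => ?_
    rw [Finset.mem_filter, hC] at hi
    rw [Finset.mem_Ioi]
    by_contra! hij
    have := hi.2
    rw [dif_neg (by omega), B.mono.lt_iff_lt] at this
    omega

theorem ne_of_exchange_left (hk : A.f k < B.f k) (hσ : ∃ i i', σ (Sum.inl i) = Sum.inr i')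
    (hC : ∀ i, C.f (π i) = if h : i ≤ k then
      Sum.elim (fun a => A.f a.1) (fun b => B.f b.1) (σ (Sum.inl ⟨i, h⟩)) else A.f i) :
    C ≠ A := by
  rintro rfl
  obtain ⟨i, i', hi⟩ := hσ
  have hfix : ∀ l, k < l → π l = l := fun l hl => by
    have := hC l
    rw [dif_neg (by omega)] at this
    exact C.mono.injective this
  have h1 := hC i
  rw [dif_pos i.2, hi, Sum.elim_inr] at h1
  have h2 : k < π i := by
    rw [← C.mono.lt_iff_lt, h1]
    exact hk.trans_le (B.mono.monotone i'.2)
  have h3 := π.injective (hfix _ h2)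
  have := i.2
  omega

end Sorting

section Spanning

variable (K : Type) [Field K] {n m : ℕ}

/-- The product of two maximal minors indexed by a pair of tuples. -/
noncomputable def uProd (p : IncTup n m × IncTup n m) : MvPolynomial (Fin m × Fin n) K :=
  uMin K n m p.1 * uMin K n m p.2

/-- The pairs indexing standard products. -/
def IsStd (p : IncTup n m × IncTup n m) : Prop := ∀ j, p.2.f j ≤ p.1.f j

/-- The rows of the generic matrix. -/
noncomputable def genRow (i : Fin m) : Fin n → MvPolynomial (Fin m × Fin n) K :=
  fun j => MvPolynomial.X (i, j)

theorem detRow_genRow_of_perm (α : Fin n → Fin m) (C : IncTup n m) (π : Equiv.Perm (Fin n))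
    (h : ∀ i, C.f (π i) = α i) :
    Matrix.detRowAlternating (fun i => genRow K (α i)) =
      Equiv.Perm.sign π • uMin K n m C := by
  have : (fun i => genRow (n := n) K (α i)) = (fun i => genRow K (C.f i)) ∘ π := by
    funext i
    simp [h]
  rw [this, AlternatingMap.map_perm]
  rfl

theorem uProd_mem_span (A B : IncTup n m) :
    uProd K (A, B) ∈ Submodule.span K (uProd K ''
      {p | IsStd p ∧ (∀ j, A.f j ≤ p.1.f j) ∧ ∀ j, p.2.f j ≤ B.f j}) := by
  induction hN : ∑ j, (m - (A.f j : ℕ)) using Nat.strong_induction_on generalizing A B with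
  | _ N ih
  by_cases hstd : IsStd (A, B)
  · exact Submodule.subset_span ⟨_, ⟨hstd, fun _ => le_rfl, fun _ => le_rfl⟩, rfl⟩
  obtain ⟨k, hk⟩ : ∃ k, A.f k < B.f k := by simpa [IsStd] using hstd
  set S := Submodule.span K (uProd K ''
      {p | IsStd p ∧ (∀ j, A.f j ≤ p.1.f j) ∧ ∀ j, p.2.f j ≤ B.f j})
  refine mul_mem_of_exchange Matrix.detRowAlternating Matrix.detRowAlternating k
    (fun i => genRow K (A.f i)) (fun i => genRow K (B.f i)) S.toAddSubgroup ?_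
  intro σ hσ
  set α : Fin n → Fin m := fun i => if h : i ≤ k then
      Sum.elim (fun a => A.f a.1) (fun b => B.f b.1) (σ (Sum.inl ⟨i, h⟩)) else A.f i with hα
  set β : Fin n → Fin m := fun i => if h : k ≤ i then
      Sum.elim (fun a => A.f a.1) (fun b => B.f b.1) (σ (Sum.inr ⟨i, h⟩)) else B.f i with hβ
  have hz : ∀ s : {i : Fin n // i ≤ k} ⊕ {i : Fin n // k ≤ i},
      Sum.elim (fun a => genRow (n := n) K (A.f a.1)) (fun b => genRow K (B.f b.1)) s =
      genRow K (Sum.elim (fun a => A.f a.1) (fun b => B.f b.1) s) := by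
    rintro (s | s) <;> rfl
  have e₁ : (fun i => if h : i ≤ k then Sum.elim (fun a => genRow (n := n) K (A.f a.1))
      (fun b => genRow K (B.f b.1)) (σ (Sum.inl ⟨i, h⟩)) else genRow K (A.f i)) =
      fun i => genRow K (α i) := by
    funext i
    simp only [hz, hα]
    split_ifs <;> rfl
  have e₂ : (fun i => if h : k ≤ i then Sum.elim (fun a => genRow (n := n) K (A.f a.1))
      (fun b => genRow K (B.f b.1)) (σ (Sum.inr ⟨i, h⟩)) else genRow K (B.f i)) =
      fun i => genRow K (β i) := by
    funext i
    simp only [hz, hβ]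
    split_ifs <;> rfl
  rw [e₁, e₂]
  by_cases hαi : Function.Injective α
  swap
  · rw [AlternatingMap.map_eq_zero_of_not_injective _ (fun i => genRow K (α i))
      (fun h => hαi (Function.Injective.of_comp (f := genRow K) h)), zero_mul]
    exact zero_mem _
  by_cases hβi : Function.Injective β
  swap
  · rw [AlternatingMap.map_eq_zero_of_not_injective _ (fun i => genRow K (β i))
      (fun h => hβi (Function.Injective.of_comp (f := genRow K) h)), mul_zero]
    exact zero_mem _
  obtain ⟨C, π, hC⟩ := exists_incTup_comp_perm α hαi
  obtain ⟨D, τ, hD⟩ := exists_incTup_comp_perm β hβi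
  have hAC := le_of_exchange_left hk hC
  have hDB := ge_of_exchange_right hk hD
  have hne := ne_of_exchange_left hk hσ hC
  have hlt : ∑ j, (m - (C.f j : ℕ)) < N := by
    rw [← hN]
    obtain ⟨j, hj⟩ : ∃ j, C.f j ≠ A.f j := by
      by_contra! hcon
      exact hne (IncTup.ext_f hcon)
    refine Finset.sum_lt_sum (fun i _ => ?_) ⟨j, Finset.mem_univ _, ?_⟩
    · have := hAC i
      omega
    · have := hAC j
      omega
  have hCD : uMin K n m C * uMin K n m D ∈ S :=
    by
    refine Submodule.span_mono (Set.image_mono ?_) (ih _ hlt C D rfl)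
    exact fun p hp => ⟨hp.1,
      fun j => (hAC j).trans (hp.2.1 j), fun j => (hp.2.2 j).trans (hDB j)⟩
  rw [detRow_genRow_of_perm K α C π hC, detRow_genRow_of_perm K β D τ hD]
  rcases Int.units_eq_one_or (Equiv.Perm.sign π) with h | h <;>
    rcases Int.units_eq_one_or (Equiv.Perm.sign τ) with h' | h' <;> simpa [h, h'] using hCD

end Spanning

section Independence

variable (K : Type) [Field K] {n m : ℕ}

/-- The exponent of the monomial `∏ⱼ X_{α(j), j} X_{β(j), j}`. -/
noncomputable def pairExp (α β : Fin n → Fin m) : Fin m × Fin n →₀ ℕ :=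
  ∑ j, (Finsupp.single (α j, j) 1 + Finsupp.single (β j, j) 1)

theorem uMin_eq_sum (A : IncTup n m) : uMin K n m A =
    ∑ σ : Equiv.Perm (Fin n), MvPolynomial.monomial
      (∑ j, Finsupp.single (A.f (σ j), j) 1) ((Equiv.Perm.sign σ : ℤ) : K) := by
  rw [uMin, Matrix.det_apply']
  refine Finset.sum_congr rfl fun σ _ => ?_
  simp only [Matrix.of_apply, MvPolynomial.X]
  rw [← MvPolynomial.monomial_sum_one, ← mul_one ((Equiv.Perm.sign σ : ℤ) : K),
    ← MvPolynomial.C_mul_monomial]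
  simp

theorem uProd_eq_sum (p : IncTup n m × IncTup n m) : uProd K p =
    ∑ σ : Equiv.Perm (Fin n), ∑ τ : Equiv.Perm (Fin n), MvPolynomial.monomial
      (pairExp (p.1.f ∘ σ) (p.2.f ∘ τ))
      (((Equiv.Perm.sign σ : ℤ) : K) * ((Equiv.Perm.sign τ : ℤ) : K)) := by
  rw [uProd, uMin_eq_sum, uMin_eq_sum, Finset.sum_mul_sum]
  simp [MvPolynomial.monomial_mul, pairExp, Finset.sum_add_distrib]

/-- The weight of an exponent for which the variable `X_{i, j}` has weight `i * j`. -/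
noncomputable def expWeight (d : Fin m × Fin n →₀ ℕ) : ℕ :=
  d.sum fun x e => e * ((x.1 : ℕ) * (x.2 : ℕ))

theorem expWeight_pairExp (α β : Fin n → Fin m) :
    expWeight (pairExp α β) = ∑ j, (α j : ℕ) * (j : ℕ) + ∑ j, (β j : ℕ) * (j : ℕ) := by
  have hadd : ∀ d e : Fin m × Fin n →₀ ℕ, expWeight (d + e) = expWeight d + expWeight e :=
    fun d e => Finsupp.sum_add_index' (by simp) (by simp [add_mul])
  let φ : (Fin m × Fin n →₀ ℕ) →+ ℕ := ⟨⟨expWeight, by simp [expWeight]⟩, hadd⟩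
  change φ (pairExp α β) = _
  rw [pairExp, map_sum, ← Finset.sum_add_distrib]
  refine Finset.sum_congr rfl fun j _ => ?_
  change expWeight _ = _
  rw [hadd]
  simp [expWeight]

theorem monovary_incTup (A : IncTup n m) :
    Monovary (fun j => (A.f j : ℕ)) (fun j : Fin n => (j : ℕ)) := fun i j hij => by
  have := A.mono.monotone (show i ≤ j from le_of_lt hij)
  exact this

theorem sum_perm_mul_le (A : IncTup n m) (σ : Equiv.Perm (Fin n)) :
    ∑ j, (A.f (σ j) : ℕ) * (j : ℕ) ≤ ∑ j, (A.f j : ℕ) * (j : ℕ) :=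
  (monovary_incTup A).sum_comp_perm_mul_le_sum_mul

theorem eq_one_of_sum_perm_mul_eq (A : IncTup n m) (σ : Equiv.Perm (Fin n))
    (h : ∑ j, (A.f (σ j) : ℕ) * (j : ℕ) = ∑ j, (A.f j : ℕ) * (j : ℕ)) : σ = 1 := by
  have hm := (monovary_incTup A).sum_comp_perm_mul_eq_sum_mul_iff.1 h
  have hs : Monotone σ := by
    intro i j hij
    rcases hij.eq_or_lt with rfl | hij
    · exact le_rfl
    · exact A.mono.le_iff_le.1 (hm hij)
  have hs' := hs.strictMono_of_injective σ.injective
  have : hs'.orderIsoOfSurjective σ σ.surjective = OrderIso.refl _ := Subsingleton.elim _ _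
  ext j
  simpa using congrArg Fin.val (congrArg (fun e : Fin n ≃o Fin n => e j) this)

theorem pairExp_apply (α β : Fin n → Fin m) (i : Fin m) (j : Fin n) :
    pairExp α β (i, j) = (if α j = i then 1 else 0) + (if β j = i then 1 else 0) := by
  classical
  simp only [pairExp, Finsupp.finsetSum_apply, Finsupp.add_apply, Finsupp.single_apply,
    Prod.mk.injEq]
  rw [Finset.sum_eq_single j] <;> simp +contextual

theorem IsStd.eq_of_pairExp_eq {p q : IncTup n m × IncTup n m} (hp : IsStd p) (hq : IsStd q)
    (h : pairExp p.1.f p.2.f = pairExp q.1.f q.2.f) : p = q := by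
  have key : ∀ j, p.1.f j = q.1.f j ∧ p.2.f j = q.2.f j := by
    intro j
    have h1 := DFunLike.congr_fun h (p.1.f j, j)
    have h2 := DFunLike.congr_fun h (p.2.f j, j)
    have h3 := DFunLike.congr_fun h (q.1.f j, j)
    have h4 := DFunLike.congr_fun h (q.2.f j, j)
    simp only [pairExp_apply] at h1 h2 h3 h4
    have := hp j
    have := hq j
    grind
  exact Prod.ext (IncTup.ext_f fun j => (key j).1) (IncTup.ext_f fun j => (key j).2)

theorem coeff_uProd_self (p : IncTup n m × IncTup n m) :
    (uProd K p).coeff (pairExp p.1.f p.2.f) = 1 := by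
  classical
  have key : ∀ σ τ : Equiv.Perm (Fin n),
      pairExp (p.1.f ∘ σ) (p.2.f ∘ τ) = pairExp p.1.f p.2.f → σ = 1 ∧ τ = 1 := by
    intro σ τ h
    have h := congrArg expWeight h
    simp only [expWeight_pairExp, Function.comp_apply] at h
    have h1 := sum_perm_mul_le p.1 σ
    have h2 := sum_perm_mul_le p.2 τ
    exact ⟨eq_one_of_sum_perm_mul_eq p.1 σ (by omega), eq_one_of_sum_perm_mul_eq p.2 τ (by omega)⟩
  rw [uProd_eq_sum]
  simp only [MvPolynomial.coeff_sum, MvPolynomial.coeff_monomial]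
  rw [Finset.sum_eq_single 1, Finset.sum_eq_single 1]
  · simp
  · exact fun τ _ hτ => if_neg fun h => hτ (key _ _ h).2
  · simp
  · exact fun σ _ hσ => Finset.sum_eq_zero fun τ _ => if_neg fun h => hσ (key _ _ h).1
  · simp

theorem eq_of_coeff_uProd_ne_zero {p q : IncTup n m × IncTup n m} (hp : IsStd p) (hq : IsStd q)
    (hw : expWeight (pairExp q.1.f q.2.f) ≤ expWeight (pairExp p.1.f p.2.f))
    (h : (uProd K q).coeff (pairExp p.1.f p.2.f) ≠ 0) : q = p := by
  classical
  rw [uProd_eq_sum] at h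
  simp only [MvPolynomial.coeff_sum, MvPolynomial.coeff_monomial] at h
  obtain ⟨σ, -, h⟩ := Finset.exists_ne_zero_of_sum_ne_zero h
  obtain ⟨τ, -, h⟩ := Finset.exists_ne_zero_of_sum_ne_zero h
  have he : pairExp (q.1.f ∘ σ) (q.2.f ∘ τ) = pairExp p.1.f p.2.f := by
    by_contra hne
    exact h (if_neg hne)
  have hw' := congrArg expWeight he
  rw [expWeight_pairExp] at hw'
  rw [expWeight_pairExp q.1.f] at hw
  simp only [Function.comp_apply] at hw'
  have h1 := sum_perm_mul_le q.1 σ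
  have h2 := sum_perm_mul_le q.2 τ
  obtain rfl := eq_one_of_sum_perm_mul_eq q.1 σ (by omega)
  obtain rfl := eq_one_of_sum_perm_mul_eq q.2 τ (by omega)
  exact hq.eq_of_pairExp_eq hp he

/-- Standard products of two maximal minors are linearly independent. -/
theorem linearIndepOn_uProd :
    LinearIndepOn K (uProd K) {p : IncTup n m × IncTup n m | IsStd p} := by
  rw [linearIndepOn_iff]
  intro l hl h0
  by_contra hne
  obtain ⟨p, hp, hmax⟩ := l.support.exists_max_image
    (fun p => expWeight (pairExp p.1.f p.2.f)) (Finsupp.support_nonempty_iff.2 hne)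
  have hc := congrArg (MvPolynomial.coeff (pairExp p.1.f p.2.f)) h0
  rw [Finsupp.linearCombination_apply, Finsupp.sum, MvPolynomial.coeff_sum,
    Finset.sum_eq_single p] at hc
  · rw [MvPolynomial.coeff_smul, coeff_uProd_self] at hc
    exact Finsupp.mem_support_iff.1 hp (by simpa using hc)
  · intro q hq hqp
    rw [MvPolynomial.coeff_smul]
    by_contra hcoeff
    exact hqp (eq_of_coeff_uProd_ne_zero K (hl hp) (hl hq) (hmax q hq)
      (right_ne_zero_of_smul hcoeff))
  · exact fun h => absurd hp h

end Independence

end SMB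

open SMB in
/-- **Straightening relation for products of maximal minors.**
If `I, I' ∈ I(n,m)` are noncomparable in the componentwise order, then `u(I)u(I')` is a
finite sum `Σᵣ bᵣ u(Iᵣ)u(I'ᵣ)` with nonzero coefficients, where each `Iᵣ` is componentwise
`≥` both `I` and `I'`, and each `I'ᵣ` is componentwise `≤` both `I` and `I'`. -/
theorem maximal_minor_straightening (K : Type) [Field K] [IsAlgClosed K]
    (n m : ℕ) (hnm : n ≤ m) (I I' : IncTup n m)
    (h₁ : ¬ ∀ j, I'.f j ≤ I.f j) (h₂ : ¬ ∀ j, I.f j ≤ I'.f j) :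
    ∃ (T : Finset (IncTup n m × IncTup n m)) (b : IncTup n m × IncTup n m → K),
      (uMin K n m I * uMin K n m I' = ∑ t ∈ T, b t • (uMin K n m t.1 * uMin K n m t.2)) ∧
      ∀ t ∈ T, b t ≠ 0 ∧
        (∀ j, I.f j ≤ t.1.f j) ∧ (∀ j, I'.f j ≤ t.1.f j) ∧
        (∀ j, t.2.f j ≤ I.f j) ∧ (∀ j, t.2.f j ≤ I'.f j) := by
  obtain ⟨l, hl, hlsum⟩ := (Finsupp.mem_span_image_iff_linearCombination K).1
    (uProd_mem_span K I I')
  obtain ⟨l', hl', hlsum'⟩ := (Finsupp.mem_span_image_iff_linearCombination K).1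
    (uProd_mem_span K I' I)
  have hll : l = l' := by
    refine sub_eq_zero.1 (linearIndepOn_iff.1 (linearIndepOn_uProd K) (l - l')
      (Submodule.sub_mem _ (fun p hp => (hl hp).1) (fun p hp => (hl' hp).1)) ?_)
    rw [map_sub, hlsum, hlsum', sub_eq_zero]
    exact mul_comm _ _
  subst hll
  refine ⟨l.support, l, hlsum.symm, fun t ht => ⟨Finsupp.mem_support_iff.1 ht,
    (hl ht).2.1, (hl' ht).2.1, (hl' ht).2.2, (hl ht).2.2⟩⟩
end
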